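/- arXiv:1210.6485 — 2 statements merged into one kernel-verified Lean document; each statement's English description precedes it below -/
import Mathlib

section
/- Let X be a local dendrite and let G be a subcontinuum of X containing every simple closed curve of X. Then there exists a continuous retraction r : X → X with image G and r restricting to the identity on G, together with a continuous homotopy h : [0,1] × X → X satisfying h(0,x) = x, h(1,x) = r(x), and r(h(t,x)) = r(x) for all t ∈ [0,1] and x ∈ X. Moreover, such a retraction r is unique, and it is characterized by the property that r maps each connected component C of X ∖ G to the unique point of (closure of C) ∩ G. -/
open Topology

/-- A continuum: a nonempty compact connected metrizable topological space. -/
def IsContinuum (X : Type*) [TopologicalSpace X] : Prop :=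
  Nonempty X ∧ CompactSpace X ∧ ConnectedSpace X ∧ TopologicalSpace.MetrizableSpace X

/-- A simple closed curve in `X`: a subspace homeomorphic to the circle. -/
def IsSimpleClosedCurve {X : Type*} [TopologicalSpace X] (S : Set X) : Prop :=
  Nonempty (S ≃ₜ AddCircle (1 : ℝ))

/-- A dendrite: a locally connected continuum containing no simple closed curve. -/
def IsDendrite (X : Type*) [TopologicalSpace X] : Prop :=
  IsContinuum X ∧ LocallyConnectedSpace X ∧ ∀ S : Set X, ¬ IsSimpleClosedCurve S

/-- A local dendrite: a continuum each of whose points has a neighborhood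
that is a dendrite. -/
def IsLocalDendrite (X : Type*) [TopologicalSpace X] : Prop :=
  IsContinuum X ∧ ∀ x : X, ∃ N : Set X, N ∈ 𝓝 x ∧ IsDendrite N

/-- A branch point of `X`: a point whose complement has at least three
connected components. -/
def IsBranchPoint {X : Type*} [TopologicalSpace X] (x : X) : Prop :=
  ∃ u v w : ConnectedComponents (↥({x}ᶜ : Set X)), u ≠ v ∧ u ≠ w ∧ v ≠ w

/-- `X ∖ {x}` has countably infinitely many connected components
(i.e. there are ℵ₀ branches at `x`). -/
def HasAlephNullBranchesAt (X : Type*) [TopologicalSpace X] (x : X) : Prop :=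
  Countable (ConnectedComponents (↥({x}ᶜ : Set X))) ∧
    Infinite (ConnectedComponents (↥({x}ᶜ : Set X)))


/-- A retraction of `X` onto `G` together with a homotopy from the identity that moves
points only along the fibers of the retraction. -/
def IsRetractionAlongFibers {X : Type*} [TopologicalSpace X] (G : Set X) (r : X → X) :
    Prop :=
  Continuous r ∧ Set.range r = G ∧ (∀ g ∈ G, r g = g) ∧
  ∃ h : unitInterval × X → X, Continuous h ∧ (∀ x, h (0, x) = x) ∧
    (∀ x, h (1, x) = r x) ∧ ∀ (t : unitInterval) (x : X), r (h (t, x)) = r x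

/-- Two points are `ε`-linked if they lie in a common preconnected set of mesh less than `ε`. -/
def Linked {X : Type*} [MetricSpace X] (ε : ℝ) (x y : X) : Prop :=
  ∃ D : Set X, IsPreconnected D ∧ x ∈ D ∧ y ∈ D ∧ ∀ u ∈ D, ∀ v ∈ D, dist u v < ε

theorem Linked.refl {X : Type*} [MetricSpace X] {ε : ℝ} (hε : 0 < ε) (x : X) : Linked ε x x :=
  ⟨{x}, isPreconnected_singleton, rfl, rfl, by rintro u rfl v rfl; simpa using hε⟩

theorem exists_isOpen_isPreconnected_subset_ball {X : Type*} [MetricSpace X]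
    [LocallyConnectedSpace X] (x : X) {ε : ℝ} (hε : 0 < ε) :
    ∃ V : Set X, IsOpen V ∧ IsPreconnected V ∧ x ∈ V ∧ V ⊆ Metric.ball x ε :=
  ⟨connectedComponentIn (Metric.ball x ε) x, Metric.isOpen_ball.connectedComponentIn,
    isPreconnected_connectedComponentIn, mem_connectedComponentIn (Metric.mem_ball_self hε),
    connectedComponentIn_subset _ _⟩

/-- In a compact locally connected space, any two points of a preconnected set are joined by a
chain in that set with `ε`-linked consecutive points, whose length depends only on `ε`. -/
theorem exists_chain_of_isPreconnected {X : Type*} [MetricSpace X] [CompactSpace X]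
    [LocallyConnectedSpace X] {ε : ℝ} (hε : 0 < ε) :
    ∃ N : ℕ, 0 < N ∧ ∀ C : Set X, IsPreconnected C → ∀ x ∈ C, ∀ y ∈ C, ∃ c : ℕ → X,
      c 0 = x ∧ c N = y ∧ (∀ i, c i ∈ C) ∧ ∀ i, Linked ε (c i) (c (i + 1)) := by
  classical
  have hε4 : 0 < ε / 4 := by positivity
  choose V hVo hVc hxV hVb using fun x : X => exists_isOpen_isPreconnected_subset_ball x hε4
  obtain ⟨t, ht⟩ := isCompact_univ.elim_finite_subcover V hVo
    (fun x _ => Set.mem_iUnion.2 ⟨x, hxV x⟩)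
  have hcov : ∀ x : X, ∃ i : t, x ∈ V i := by
    intro x
    obtain ⟨i, hi, hx⟩ := Set.mem_iUnion₂.1 (ht (Set.mem_univ x))
    exact ⟨⟨i, hi⟩, hx⟩
  refine ⟨Fintype.card t + 2, by omega, ?_⟩
  intro C hC x hx y hy
  let meets : t → t → Prop := fun i j => ∃ p ∈ C, p ∈ V i ∧ p ∈ V j
  let Γ : SimpleGraph t := SimpleGraph.fromRel meets
  have hadj : ∀ i j : t, meets i j → Γ.Reachable i j := by
    intro i j h
    by_cases hij : i = j
    · exact hij ▸ SimpleGraph.Reachable.refl _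
    · exact SimpleGraph.Adj.reachable ((SimpleGraph.fromRel_adj _ _ _).2 ⟨hij, Or.inl h⟩)
  have hmeets_symm : ∀ i j : t, meets i j → meets j i := by
    rintro i j ⟨p, hp, h1, h2⟩
    exact ⟨p, hp, h2, h1⟩
  have hreach : ∀ i j : t, x ∈ V i → y ∈ V j → Γ.Reachable i j := by
    refine hC.induction₂ (fun x y => ∀ i j : t, x ∈ V i → y ∈ V j → Γ.Reachable i j)
      ?_ ?_ ?_ hx hy
    · intro a ha
      obtain ⟨i₀, hi₀⟩ := hcov a
      filter_upwards [mem_nhdsWithin_of_mem_nhds ((hVo i₀).mem_nhds hi₀), self_mem_nhdsWithin]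
        with b hb hbC i j hi hj
      exact (hadj i i₀ ⟨a, ha, hi, hi₀⟩).trans (hadj i₀ j ⟨b, hbC, hb, hj⟩)
    · intro a b d _ _ _ hab hbd i j hi hj
      obtain ⟨k, hk⟩ := hcov b
      exact (hab i k hi hk).trans (hbd k j hk hj)
    · intro a b _ _ hab i j hi hj
      exact (hab j i hj hi).symm
  obtain ⟨i₀, hi₀⟩ := hcov x
  obtain ⟨j₀, hj₀⟩ := hcov y
  obtain ⟨w⟩ := hreach i₀ j₀ hi₀ hj₀
  let p := w.toPath
  have hlen : (p : Γ.Walk i₀ j₀).length < Fintype.card t := p.2.length_lt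
  let v : ℕ → t := (p : Γ.Walk i₀ j₀).getVert
  have hv0 : v 0 = i₀ := SimpleGraph.Walk.getVert_zero _
  have hvN : v (Fintype.card t) = j₀ := SimpleGraph.Walk.getVert_of_length_le _ hlen.le
  have hvadj : ∀ j, v j = v (j + 1) ∨ meets (v j) (v (j + 1)) := by
    intro j
    by_cases hj : j < (p : Γ.Walk i₀ j₀).length
    · have := SimpleGraph.Walk.adj_getVert_succ (p : Γ.Walk i₀ j₀) hj
      rcases ((SimpleGraph.fromRel_adj _ _ _).1 this).2 with h | h
      · exact Or.inr h
      · exact Or.inr (hmeets_symm _ _ h)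
    · left
      have h1 : v j = j₀ := SimpleGraph.Walk.getVert_of_length_le _ (by omega)
      have h2 : v (j + 1) = j₀ := SimpleGraph.Walk.getVert_of_length_le _ (by omega)
      rw [h1, h2]
  have hvC : ∀ j, ∃ q ∈ C, q ∈ V (v j) := by
    intro j
    induction j with
    | zero => exact ⟨x, hx, by rw [hv0]; exact hi₀⟩
    | succ j ih =>
      rcases hvadj j with h | ⟨q, hq, -, h⟩
      · rw [← h]; exact ih
      · exact ⟨q, hq, h⟩
  choose e heC heV using hvC
  have hdist : ∀ i : t, ∀ a ∈ V i, ∀ b ∈ V i, dist a b < ε / 2 := by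
    intro i a ha b hb
    have h1 := hVb i ha
    have h2 := hVb i hb
    rw [Metric.mem_ball] at h1 h2
    linarith [dist_triangle_right a b (i : X)]
  have hlink1 : ∀ i : t, ∀ a ∈ V i, ∀ b ∈ V i, Linked ε a b := fun i a ha b hb =>
    ⟨V i, hVc i, ha, hb, fun u hu v hv => (hdist i u hu v hv).trans (by linarith)⟩
  have hlink2 : ∀ i j : t, meets i j → ∀ a ∈ V i, ∀ b ∈ V j, Linked ε a b := by
    rintro i j ⟨q, -, hqi, hqj⟩ a ha b hb
    refine ⟨V i ∪ V j, (hVc i).union q hqi hqj (hVc j), Or.inl ha, Or.inr hb, ?_⟩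
    have hq : ∀ u ∈ V i ∪ V j, dist u q < ε / 2 := by
      rintro u (hu | hu)
      · exact hdist i u hu q hqi
      · exact hdist j u hu q hqj
    intro u hu w hw
    linarith [hq u hu, hq w hw, dist_triangle_right u w q]
  refine ⟨fun j => if j = 0 then x else if j ≤ Fintype.card t + 1 then e (j - 1) else y,
    by simp, by simp, ?_, ?_⟩
  · intro i
    dsimp only
    split_ifs
    exacts [hx, heC _, hy]
  · intro i
    rcases Nat.eq_zero_or_pos i with rfl | hi
    · simpa using hlink1 i₀ x hi₀ _ (by simpa [hv0] using heV 0)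
    · obtain ⟨k, rfl⟩ : ∃ k, i = k + 1 := ⟨i - 1, by omega⟩
      rcases lt_trichotomy k (Fintype.card t) with h | h | h
      · simp only [Nat.add_eq_zero_iff, one_ne_zero, and_false, if_false, Nat.add_sub_cancel]
        rw [if_pos (by omega), if_pos (by omega)]
        rcases hvadj k with h' | h'
        · exact hlink1 (v k) _ (heV k) _ (by rw [h']; exact heV _)
        · exact hlink2 _ _ h' _ (heV k) _ (heV _)
      · simp only [Nat.add_eq_zero_iff, one_ne_zero, and_false, if_false, Nat.add_sub_cancel]
        rw [if_pos (by omega), if_neg (by omega)]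
        exact hlink1 j₀ _ (by rw [← hvN, ← h]; exact heV k) _ hj₀
      · simp only [Nat.add_eq_zero_iff, one_ne_zero, and_false, if_false, Nat.add_sub_cancel]
        rw [if_neg (by omega), if_neg (by omega)]
        exact Linked.refl hε y

/-- A chain of related points can be filled in to a continuous path when each relation can be
refined, in a uniformly bounded number of steps, to the next one. -/
theorem exists_continuousOn_of_refinement {X : Type*} [MetricSpace X] [CompleteSpace X] {B : ℝ}
    (R : ℕ → X → X → Prop)
    (hR : ∀ n, ∃ N : ℕ, 0 < N ∧ ∀ x y, R n x y → ∃ c : ℕ → X, c 0 = x ∧ c N = y ∧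
      (∀ i, dist x (c i) ≤ B / 2 / 2 ^ n) ∧ ∀ i, R (n + 1) (c i) (c (i + 1)))
    (c : ℕ → X) (hc : ∀ i, R 0 (c i) (c (i + 1))) :
    ∃ γ : ℝ → X, ContinuousOn γ (Set.Ici 0) ∧ (∀ i : ℕ, γ i = c i) ∧
      ∀ t : ℝ, 0 ≤ t → dist (c ⌊t⌋₊) (γ t) ≤ B := by
  classical
  choose N hN hch using hR
  let σ : ℕ → X → X → ℕ → X := fun n x y =>
    if h : R n x y then (hch n x y h).choose else fun _ => x
  have hσ : ∀ n x y, R n x y → σ n x y 0 = x ∧ σ n x y (N n) = y ∧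
      (∀ i, dist x (σ n x y i) ≤ B / 2 / 2 ^ n) ∧
      ∀ i, R (n + 1) (σ n x y i) (σ n x y (i + 1)) := by
    intro n x y h
    simp only [σ, dif_pos h]
    exact (hch n x y h).choose_spec
  let g : ℕ → ℕ → X := fun n => Nat.rec c
    (fun n f j => σ n (f (j / N n)) (f (j / N n + 1)) (j % N n)) n
  have g0 : g 0 = c := rfl
  have gs : ∀ n j, g (n + 1) j = σ n (g n (j / N n)) (g n (j / N n + 1)) (j % N n) :=
    fun n j => rfl
  have hg : ∀ n i, R n (g n i) (g n (i + 1)) := by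
    intro n
    induction n with
    | zero => exact hc
    | succ n ih =>
      intro j
      obtain ⟨h0, hl, -, hs⟩ := hσ n _ _ (ih (j / N n))
      have hmod := Nat.mod_lt j (hN n)
      have hdm := Nat.div_add_mod j (N n)
      rcases Nat.lt_or_ge (j % N n + 1) (N n) with h | h
      · have hd : (j + 1) / N n = j / N n := by
          rw [show j + 1 = j % N n + 1 + N n * (j / N n) by omega,
            Nat.add_mul_div_left _ _ (hN n), Nat.div_eq_of_lt h, zero_add]
        have hm : (j + 1) % N n = j % N n + 1 := by
          have := Nat.div_add_mod (j + 1) (N n)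
          rw [hd] at this
          omega
        rw [gs, gs, hd, hm]
        exact hs _
      · have he : j % N n + 1 = N n := by omega
        have hj : j + 1 = N n * (j / N n + 1) := by rw [mul_add]; omega
        have hd : (j + 1) / N n = j / N n + 1 := by rw [hj, Nat.mul_div_cancel_left _ (hN n)]
        have hm : (j + 1) % N n = 0 := by rw [hj, Nat.mul_mod_right]
        rw [gs, gs n (j + 1), hd, hm, (hσ n _ _ (ih (j / N n + 1))).1]
        have := hs (j % N n)
        rwa [he, hl] at this
  have hgd : ∀ n i, dist (g n i) (g n (i + 1)) ≤ B / 2 / 2 ^ n := by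
    intro n i
    obtain ⟨-, hl, hd, -⟩ := hσ n _ _ (hg n i)
    have := hd (N n)
    rwa [hl] at this
  let M : ℕ → ℕ := fun n => ∏ k ∈ Finset.range n, N k
  have hM : ∀ n, 0 < M n := fun n => Finset.prod_pos fun k _ => hN k
  have hMs : ∀ n, M (n + 1) = M n * N n := fun n => Finset.prod_range_succ _ _
  have hfl : ∀ (t : ℝ) n, ⌊t * M (n + 1)⌋₊ / N n = ⌊t * M n⌋₊ := by
    intro t n
    rw [← Nat.floor_div_natCast, hMs]
    congr 1
    have : (N n : ℝ) ≠ 0 := by exact_mod_cast (hN n).ne'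
    push_cast
    field_simp
  have hstep : ∀ (t : ℝ) n, dist (g n ⌊t * M n⌋₊) (g (n + 1) ⌊t * M (n + 1)⌋₊) ≤
      B / 2 / 2 ^ n := by
    intro t n
    rw [gs, hfl]
    exact (hσ n _ _ (hg n _)).2.2.1 _
  have hlim : ∀ t : ℝ, ∃ y, Filter.Tendsto (fun n => g n ⌊t * M n⌋₊) Filter.atTop (𝓝 y) :=
    fun t => cauchySeq_tendsto_of_complete (cauchySeq_of_le_geometric_two (hstep t))
  choose γ hγ using hlim
  have hdist : ∀ (t : ℝ) n, dist (g n ⌊t * M n⌋₊) (γ t) ≤ B / 2 ^ n := fun t n =>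
    dist_le_of_le_geometric_two_of_tendsto (hstep t) (hγ t) n
  have hBn : Filter.Tendsto (fun n : ℕ => 3 * (B / 2 ^ n)) Filter.atTop (𝓝 0) := by
    have := (tendsto_pow_atTop_nhds_zero_of_lt_one (r := (1 / 2 : ℝ)) (by norm_num)
      (by norm_num)).const_mul (3 * B)
    simp only [mul_zero] at this
    refine this.congr fun n => ?_
    rw [one_div, inv_pow]
    ring
  refine ⟨γ, ?_, ?_, ?_⟩
  · rw [Metric.continuousOn_iff]
    intro t ht η hη
    obtain ⟨n, hn⟩ := ((hBn.eventually (gt_mem_nhds hη))).exists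
    have hMn : (0 : ℝ) < M n := by exact_mod_cast hM n
    refine ⟨1 / M n, by positivity, fun s hs hst => ?_⟩
    have hB0 : 0 ≤ B / 2 / 2 ^ n := dist_nonneg.trans (hgd n 0)
    have key : dist (g n ⌊s * M n⌋₊) (g n ⌊t * M n⌋₊) ≤ B / 2 / 2 ^ n := by
      have hs0 : 0 ≤ s * M n := mul_nonneg hs hMn.le
      have ht0 : 0 ≤ t * M n := mul_nonneg ht hMn.le
      have habs : |s * M n - t * M n| < 1 := by
        rw [← sub_mul, abs_mul, abs_of_pos hMn, ← Real.dist_eq]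
        rwa [lt_div_iff₀ hMn] at hst
      rw [abs_lt] at habs
      have f1 := Nat.floor_le hs0
      have f2 := Nat.lt_floor_add_one (s * (M n : ℝ))
      have f3 := Nat.floor_le ht0
      have f4 := Nat.lt_floor_add_one (t * (M n : ℝ))
      have h1 : ⌊s * M n⌋₊ < ⌊t * M n⌋₊ + 2 := by
        have : (⌊s * M n⌋₊ : ℝ) < ⌊t * M n⌋₊ + 2 := by linarith [habs.2]
        exact_mod_cast this
      have h2 : ⌊t * M n⌋₊ < ⌊s * M n⌋₊ + 2 := by
        have : (⌊t * M n⌋₊ : ℝ) < ⌊s * M n⌋₊ + 2 := by linarith [habs.1]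
        exact_mod_cast this
      rcases (by omega : ⌊s * M n⌋₊ = ⌊t * M n⌋₊ ∨ ⌊t * M n⌋₊ = ⌊s * M n⌋₊ + 1 ∨
        ⌊s * M n⌋₊ = ⌊t * M n⌋₊ + 1) with h | h | h
      · rw [h, dist_self]; exact hB0
      · rw [h]; exact hgd n _
      · rw [h, dist_comm]; exact hgd n _
    have h4 := dist_triangle4 (γ s) (g n ⌊s * M n⌋₊) (g n ⌊t * M n⌋₊) (γ t)
    have h5 := hdist s n
    have h6 := hdist t n
    rw [dist_comm] at h5
    have h7 : B / 2 / 2 ^ n = B / 2 ^ n / 2 := by ring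
    rw [h7] at hB0 key
    linarith
  · intro i
    refine tendsto_nhds_unique (hγ i) ?_
    have : ∀ n, g n (i * M n) = c i := by
      intro n
      induction n with
      | zero => simp [g0, M]
      | succ n ih =>
        have h1 : i * M (n + 1) / N n = i * M n := by
          rw [hMs, ← mul_assoc, Nat.mul_div_cancel _ (hN n)]
        have h2 : i * M (n + 1) % N n = 0 := by rw [hMs, ← mul_assoc, Nat.mul_mod_left]
        rw [gs, h1, h2, (hσ n _ _ (hg n _)).1, ih]
    have h2 : ∀ n, ⌊(i : ℝ) * M n⌋₊ = i * M n := by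
      intro n
      rw [← Nat.cast_mul, Nat.floor_natCast]
    simp only [h2, this]
    exact tendsto_const_nhds
  · intro t _
    have := hdist t 0
    simpa [g0, M] using this

/-- In a compact locally connected metric space, any two points of a preconnected set are joined
by a path staying close to that set. -/
theorem exists_path_thickening {X : Type*} [MetricSpace X] [CompactSpace X]
    [LocallyConnectedSpace X] {C : Set X} (hC : IsPreconnected C) {x y : X} (hx : x ∈ C)
    (hy : y ∈ C) {ε : ℝ} (hε : 0 < ε) :
    ∃ (b : ℝ) (γ : ℝ → X), 0 < b ∧ ContinuousOn γ (Set.Icc 0 b) ∧ γ 0 = x ∧ γ b = y ∧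
      ∀ t ∈ Set.Icc 0 b, γ t ∈ Metric.thickening ε C := by
  set B := ε / 2 with hB
  have hpos : ∀ n : ℕ, 0 < B / 2 / 2 ^ n := fun n => by positivity
  obtain ⟨N, hN, hch⟩ := exists_chain_of_isPreconnected (X := X) (hpos 0)
  obtain ⟨c, hc0, hcN, hcC, hc⟩ := hch C hC x hx y hy
  obtain ⟨γ, hγ, hγc, hγd⟩ := exists_continuousOn_of_refinement (B := B)
    (fun n => Linked (B / 2 / 2 ^ n)) (by
      intro n
      obtain ⟨N, hN, hch⟩ := exists_chain_of_isPreconnected (X := X) (hpos (n + 1))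
      refine ⟨N, hN, ?_⟩
      rintro x y ⟨D, hD, hxD, hyD, hd⟩
      obtain ⟨c, hc0, hcN, hcD, hc⟩ := hch D hD x hxD y hyD
      exact ⟨c, hc0, hcN, fun i => (hd x hxD _ (hcD i)).le, hc⟩) c hc
  refine ⟨N, γ, by exact_mod_cast hN, hγ.mono fun t ht => ht.1, ?_, ?_, ?_⟩
  · rw [← hc0, ← hγc 0, Nat.cast_zero]
  · rw [← hcN, ← hγc N]
  · intro t ht
    rw [Metric.mem_thickening_iff]
    refine ⟨c ⌊t⌋₊, hcC _, ?_⟩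
    rw [dist_comm]
    exact (hγd t ht.1).trans_lt (by rw [hB]; linarith)

/-- A function on a compact set that is constant on the fibers of a continuous map descends to a
continuous function on the image. -/
theorem IsCompact.exists_continuousOn_image {K Y Z : Type*} [TopologicalSpace K]
    [TopologicalSpace Y] [TopologicalSpace Z] [T2Space Y] [Nonempty Z] {T : Set K}
    (hT : IsCompact T) {φ : K → Y} {f : K → Z} (hφ : ContinuousOn φ T) (hf : ContinuousOn f T)
    (h : ∀ s ∈ T, ∀ t ∈ T, φ s = φ t → f s = f t) :
    ∃ g : Y → Z, ContinuousOn g (φ '' T) ∧ ∀ s ∈ T, g (φ s) = f s := by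
  classical
  let g : Y → Z := fun y => if hy : ∃ s ∈ T, φ s = y then f hy.choose else Classical.arbitrary Z
  have hg : ∀ s ∈ T, g (φ s) = f s := by
    intro s hs
    have hy : ∃ s' ∈ T, φ s' = φ s := ⟨s, hs, rfl⟩
    simp only [g, dif_pos hy]
    exact h _ hy.choose_spec.1 _ hs hy.choose_spec.2
  refine ⟨g, ?_, hg⟩
  rw [continuousOn_iff_isClosed]
  intro F hF
  obtain ⟨u, hu, huF⟩ := continuousOn_iff_isClosed.1 hf F hF
  refine ⟨φ '' (u ∩ T), ((hT.inter_left hu).image_of_continuousOn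
    (hφ.mono Set.inter_subset_right)).isClosed, ?_⟩
  ext y
  constructor
  · rintro ⟨hy, s, hs, rfl⟩
    refine ⟨⟨s, ?_, rfl⟩, s, hs, rfl⟩
    rw [← huF]
    exact ⟨by rw [Set.mem_preimage, ← hg s hs]; exact hy, hs⟩
  · rintro ⟨⟨s, hs, rfl⟩, hy⟩
    refine ⟨?_, hy⟩
    rw [← huF] at hs
    rw [Set.mem_preimage, hg s hs.2]
    exact hs.1

/-- A size function on the nonempty subsets of a compact metric space: it is uniformly continuous
for the one-sided Hausdorff distance, and strictly increasing on closed sets. -/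
theorem exists_whitney_map (X : Type*) [MetricSpace X] [CompactSpace X] [Nonempty X] :
    ∃ W : Set X → ℝ,
      (∀ (A B : Set X) (η : ℝ), A.Nonempty → B.Nonempty →
        (∀ b ∈ B, ∃ a ∈ A, dist b a ≤ η) → W B ≤ W A + 2 * η) ∧
      ∀ A B : Set X, A.Nonempty → IsClosed A → A ⊆ B → ¬ B ⊆ A → W A < W B := by
  let z := TopologicalSpace.denseSeq X
  have hz : DenseRange z := TopologicalSpace.denseRange_denseSeq X
  have hsum : ∀ A : Set X, A.Nonempty →
      Summable fun n => (1 / 2 : ℝ) ^ n * Metric.infDist (z n) A := by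
    rintro A ⟨a, ha⟩
    refine Summable.of_nonneg_of_le (fun n => by have := @Metric.infDist_nonneg _ _ A (z n); positivity)
      (fun n => ?_) (summable_geometric_two.mul_right (Metric.diam (Set.univ : Set X)))
    gcongr
    exact (Metric.infDist_le_dist_of_mem ha).trans
      (Metric.dist_le_diam_of_mem isCompact_univ.isBounded trivial trivial)
  refine ⟨fun A => -∑' n, (1 / 2 : ℝ) ^ n * Metric.infDist (z n) A, ?_, ?_⟩
  · intro A B η hA hB h
    have key : ∀ x, Metric.infDist x A ≤ Metric.infDist x B + η := by
      intro x
      refine le_of_forall_pos_lt_add fun ε hε => ?_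
      obtain ⟨b, hb, hxb⟩ := (Metric.infDist_lt_iff hB).1 (lt_add_of_pos_right (Metric.infDist x B) hε)
      obtain ⟨a, ha, hba⟩ := h b hb
      have := Metric.infDist_le_dist_of_mem (x := x) ha
      linarith [dist_triangle x b a]
    have h2 : ∑' n, (1 / 2 : ℝ) ^ n * Metric.infDist (z n) A ≤
        ∑' n, ((1 / 2 : ℝ) ^ n * Metric.infDist (z n) B + (1 / 2 : ℝ) ^ n * η) := by
      refine (hsum A hA).tsum_le_tsum (fun n => ?_)
        ((hsum B hB).add (summable_geometric_two.mul_right η))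
      rw [← mul_add]
      gcongr
      exact key _
    rw [(hsum B hB).tsum_add (summable_geometric_two.mul_right η), tsum_mul_right,
      tsum_geometric_two] at h2
    linarith
  · intro A B hA hAc hAB hBA
    obtain ⟨b, hb, hbA⟩ := Set.not_subset.1 hBA
    have hpos : 0 < Metric.infDist b A := (hAc.notMem_iff_infDist_pos hA).1 hbA
    obtain ⟨n, hn⟩ := hz.exists_dist_lt b (half_pos hpos)
    refine neg_lt_neg ((hsum B (hA.mono hAB)).tsum_lt_tsum (i := n) (fun m => ?_) ?_ (hsum A hA))
    · have := Metric.infDist_le_infDist_of_subset (x := z m) hAB hA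
      gcongr
    · gcongr
      have h1 : Metric.infDist (z n) B ≤ dist (z n) b := Metric.infDist_le_dist_of_mem hb
      have h2 := Metric.infDist_le_infDist_add_dist (s := A) (x := b) (y := z n)
      rw [dist_comm] at h1
      linarith

/-- Loop erasure: a path restricts to a closed set of times on which two values coincide exactly
when the times bound a gap. -/
theorem exists_loop_erasure {X : Type*} [MetricSpace X] {f : ℝ → X} {a b : ℝ} (hab : a ≤ b)
    (hf : ContinuousOn f (Set.Icc a b)) :
    ∃ T : Set ℝ, IsClosed T ∧ T ⊆ Set.Icc a b ∧ a ∈ T ∧ b ∈ T ∧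
      ∀ s ∈ T, ∀ t ∈ T, s < t → (f s = f t ↔ Set.Ioo s t ∩ T = ∅) := by
  let S : Set (Set ℝ) := {T | IsClosed T ∧ T ⊆ Set.Icc a b ∧ a ∈ T ∧ b ∈ T ∧
    ∀ s ∈ T, ∀ t ∈ T, s < t → Set.Ioo s t ∩ T = ∅ → f s = f t}
  obtain ⟨T, hT⟩ : ∃ T, Minimal (· ∈ S) T := by
    refine zorn_superset S fun c hcS hc => ?_
    rcases c.eq_empty_or_nonempty with rfl | hne
    · refine ⟨Set.Icc a b, ⟨isClosed_Icc, subset_rfl, Set.left_mem_Icc.2 hab,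
        Set.right_mem_Icc.2 hab, fun s hs t ht hst h => ?_⟩, by simp⟩
      have hm : (s + t) / 2 ∈ Set.Ioo s t ∩ Set.Icc a b := by
        refine ⟨⟨by linarith, by linarith⟩, by linarith [hs.1, ht.1], by linarith [hs.2, ht.2]⟩
      rw [h] at hm
      exact hm.elim
    · obtain ⟨T₀, hT₀⟩ := hne
      have hcl : IsClosed (⋂₀ c) := isClosed_sInter fun T hT => (hcS hT).1
      refine ⟨⋂₀ c, ⟨hcl, (Set.sInter_subset_of_mem hT₀).trans (hcS hT₀).2.1,
        fun T hT => (hcS hT).2.2.1, fun T hT => (hcS hT).2.2.2.1, ?_⟩,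
        fun T hT => Set.sInter_subset_of_mem hT⟩
      intro s hs t ht hst hgap
      have hsI := (hcS hT₀).2.1 (hs T₀ hT₀)
      have htI := (hcS hT₀).2.1 (ht T₀ hT₀)
      refine eq_of_forall_dist_le fun η hη => ?_
      obtain ⟨δ₁, hδ₁, h₁⟩ := Metric.continuousOn_iff.1 hf s hsI (η / 2) (half_pos hη)
      obtain ⟨δ₂, hδ₂, h₂⟩ := Metric.continuousOn_iff.1 hf t htI (η / 2) (half_pos hη)
      set δ := min (min (δ₁ / 2) (δ₂ / 2)) ((t - s) / 3) with hδ
      have hδ0 : 0 < δ := by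
        have : 0 < t - s := sub_pos.2 hst
        positivity
      have hδa : δ ≤ δ₁ / 2 := (min_le_left _ _).trans (min_le_left _ _)
      have hδb : δ ≤ δ₂ / 2 := (min_le_left _ _).trans (min_le_right _ _)
      have hδc : δ ≤ (t - s) / 3 := min_le_right _ _
      obtain ⟨T', hT'c, hT'⟩ : ∃ T' ∈ c, Set.Icc (s + δ) (t - δ) ∩ T' = ∅ := by
        have : Nonempty c := ⟨⟨T₀, hT₀⟩⟩
        obtain ⟨i, hi⟩ := (isCompact_Icc (a := s + δ) (b := t - δ)).elim_directed_family_closed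
          (fun T : c => (T : Set ℝ)) (fun T => (hcS T.2).1) (by
            rw [← Set.sInter_eq_iInter, Set.eq_empty_iff_forall_notMem]
            rintro u ⟨hu, huT⟩
            have : u ∈ Set.Ioo s t ∩ ⋂₀ c := ⟨⟨by linarith [hu.1], by linarith [hu.2]⟩, huT⟩
            rw [hgap] at this
            exact this) (by
            intro T₁ T₂
            rcases hc.total T₁.2 T₂.2 with h | h
            · exact ⟨T₁, subset_rfl, h⟩
            · exact ⟨T₂, h, subset_rfl⟩)
        exact ⟨i, i.2, hi⟩
      have hS' := hcS hT'c
      have hsT' := hs T' hT'c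
      have htT' := ht T' hT'c
      obtain ⟨s', hs'⟩ := ((isCompact_Icc (a := s) (b := s + δ)).inter_right hS'.1).exists_isGreatest
        ⟨s, ⟨le_rfl, by linarith⟩, hsT'⟩
      obtain ⟨t', ht'⟩ := ((isCompact_Icc (a := t - δ) (b := t)).inter_right hS'.1).exists_isLeast
        ⟨t, ⟨by linarith, le_rfl⟩, htT'⟩
      have hfst : f s' = f t' := by
        refine hS'.2.2.2.2 s' hs'.1.2 t' ht'.1.2 (by linarith [hs'.1.1.2, ht'.1.1.1]) ?_
        rw [Set.eq_empty_iff_forall_notMem]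
        rintro u ⟨hu, huT⟩
        rcases le_or_gt u (s + δ) with h | h
        · exact absurd (hs'.2 ⟨⟨by linarith [hs'.1.1.1, hu.1], h⟩, huT⟩) (not_le.2 hu.1)
        · rcases le_or_gt (t - δ) u with h' | h'
          · exact absurd (ht'.2 ⟨⟨h', by linarith [ht'.1.1.2, hu.2]⟩, huT⟩) (not_le.2 hu.2)
          · have : u ∈ Set.Icc (s + δ) (t - δ) ∩ T' := ⟨⟨h.le, h'.le⟩, huT⟩
            rw [hT'] at this
            exact this
      have d1 := h₁ s' (hS'.2.1 hs'.1.2) (by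
        rw [Real.dist_eq, abs_lt]
        constructor <;> linarith [hs'.1.1.1, hs'.1.1.2])
      have d2 := h₂ t' (hS'.2.1 ht'.1.2) (by
        rw [Real.dist_eq, abs_lt]
        constructor <;> linarith [ht'.1.1.1, ht'.1.1.2])
      rw [hfst, dist_comm] at d1
      linarith [dist_triangle (f s) (f t') (f t)]
  obtain ⟨hTc, hTI, haT, hbT, hTg⟩ := hT.1
  refine ⟨T, hTc, hTI, haT, hbT, fun s hs t ht hst => ⟨fun hfst => ?_, hTg s hs t ht hst⟩⟩
  have hmem : T \ Set.Ioo s t ∈ S := by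
    refine ⟨hTc.sdiff isOpen_Ioo, Set.sdiff_subset.trans hTI, ⟨haT, fun h => ?_⟩,
      ⟨hbT, fun h => ?_⟩, ?_⟩
    · exact absurd h.1 (not_lt.2 (hTI hs).1)
    · exact absurd h.2 (not_lt.2 (hTI ht).2)
    · rintro s₁ ⟨hs₁, hs₁'⟩ t₁ ⟨ht₁, ht₁'⟩ hlt hgap
      by_cases hg : Set.Ioo s₁ t₁ ∩ T = ∅
      · exact hTg s₁ hs₁ t₁ ht₁ hlt hg
      obtain ⟨u, hu, huT⟩ := Set.nonempty_iff_ne_empty.2 hg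
      have hnot : ∀ v ∈ Set.Ioo s₁ t₁, v ∈ T → v ∈ Set.Ioo s t := by
        intro v hv hvT
        by_contra hvn
        have : v ∈ Set.Ioo s₁ t₁ ∩ (T \ Set.Ioo s t) := ⟨hv, hvT, hvn⟩
        rw [hgap] at this
        exact this
      have hust := hnot u hu huT
      have e1 : s₁ = s := by
        have h1 : s₁ ≤ s := by
          by_contra hcon
          exact hs₁' ⟨not_le.1 hcon, hu.1.trans hust.2⟩
        by_contra hcon
        exact absurd (hnot s ⟨lt_of_le_of_ne h1 hcon, hust.1.trans hu.2⟩ hs).1 (lt_irrefl _)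
      have e2 : t₁ = t := by
        have h1 : t ≤ t₁ := by
          by_contra hcon
          exact ht₁' ⟨hust.1.trans hu.2, not_le.1 hcon⟩
        by_contra hcon
        exact absurd (hnot t ⟨hu.1.trans hust.2, lt_of_le_of_ne h1 (Ne.symm hcon)⟩ ht).2
          (lt_irrefl _)
      rw [e1, e2, hfst]
  have hsub : T ⊆ T \ Set.Ioo s t := hT.2 hmem Set.sdiff_subset
  rw [Set.eq_empty_iff_forall_notMem]
  exact fun u hu => (hsub hu.2).2 hu.1

/-- The range of a nonclosed path in a compact metric space contains an arc between its
endpoints. -/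
theorem exists_arc_of_path {X : Type*} [MetricSpace X] [CompactSpace X] {f : ℝ → X} {a b : ℝ}
    (hab : a ≤ b) (hf : ContinuousOn f (Set.Icc a b)) (hne : f a ≠ f b) :
    ∃ (c d : ℝ) (g : ℝ → X), c < d ∧ ContinuousOn g (Set.Icc c d) ∧
      Set.InjOn g (Set.Icc c d) ∧ g c = f a ∧ g d = f b ∧
      g '' Set.Icc c d ⊆ f '' Set.Icc a b := by
  have : Nonempty X := ⟨f a⟩
  obtain ⟨W, hWlip, hWstrict⟩ := exists_whitney_map X
  obtain ⟨T, hTc, hTI, haT, hbT, hTg⟩ := exists_loop_erasure hab hf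
  have hTcpt : IsCompact T := isCompact_Icc.of_isClosed_subset hTc hTI
  have hfT : ContinuousOn f T := hf.mono hTI
  let A : ℝ → Set X := fun u => f '' (Set.Icc a u ∩ T)
  have hAne : ∀ u, a ≤ u → (A u).Nonempty := fun u hu =>
    ⟨f a, a, ⟨⟨le_rfl, hu⟩, haT⟩, rfl⟩
  have hAcl : ∀ u, IsClosed (A u) := fun u =>
    ((hTcpt.inter_left isClosed_Icc).image_of_continuousOn
      (hfT.mono Set.inter_subset_right)).isClosed
  have hAmono : ∀ u v, u ≤ v → A u ⊆ A v := fun u v huv =>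
    Set.image_mono (Set.inter_subset_inter_left _ (Set.Icc_subset_Icc_right huv))
  let φ : ℝ → ℝ := fun u => W (A u)
  have hφmono : ∀ u ∈ T, ∀ v ∈ T, u ≤ v → φ u ≤ φ v := by
    intro u hu v hv huv
    have := hWlip (A v) (A u) 0 (hAne v (hTI hv).1) (hAne u (hTI hu).1)
      (fun x hx => ⟨x, hAmono u v huv hx, by simp⟩)
    simpa using this
  have hφeq : ∀ u ∈ T, ∀ v ∈ T, u < v → f u = f v → φ u = φ v := by
    intro u hu v hv huv hfuv
    have hgap := (hTg u hu v hv huv).1 hfuv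
    have : A u = A v := by
      refine (hAmono u v huv.le).antisymm ?_
      rintro _ ⟨t, ⟨⟨hat, htv⟩, htT⟩, rfl⟩
      rcases le_or_gt t u with h | h
      · exact ⟨t, ⟨⟨hat, h⟩, htT⟩, rfl⟩
      · have htv' : t = v := by
          by_contra hcon
          have : t ∈ Set.Ioo u v ∩ T := ⟨⟨h, lt_of_le_of_ne htv hcon⟩, htT⟩
          rw [hgap] at this
          exact this
        exact ⟨u, ⟨⟨(hTI hu).1, le_rfl⟩, hu⟩, by rw [htv', hfuv]⟩
    simp only [φ, this]
  have hφlt : ∀ u ∈ T, ∀ v ∈ T, u < v → φ u = φ v → f u = f v := by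
    intro u hu v hv huv hφuv
    by_contra hcon
    refine (hWstrict (A u) (A v) (hAne u (hTI hu).1) (hAcl u) (hAmono u v huv.le) ?_).ne hφuv
    intro hsub
    obtain ⟨t, ⟨⟨hat, htu⟩, htT⟩, htv⟩ := hsub ⟨v, ⟨⟨(hTI hv).1, le_rfl⟩, hv⟩, rfl⟩
    have hgap := (hTg t htT v hv (htu.trans_lt huv)).1 htv
    rcases htu.eq_or_lt with h | h
    · exact hcon (by rw [← h, htv])
    · have : u ∈ Set.Ioo t v ∩ T := ⟨⟨h, huv⟩, hu⟩
      rw [hgap] at this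
      exact this
  have hφiff : ∀ u ∈ T, ∀ v ∈ T, (φ u = φ v ↔ f u = f v) := by
    intro u hu v hv
    rcases lt_trichotomy u v with h | rfl | h
    · exact ⟨hφlt u hu v hv h, hφeq u hu v hv h⟩
    · simp
    · exact ⟨fun e => (hφlt v hv u hu h e.symm).symm, fun e => (hφeq v hv u hu h e.symm).symm⟩
  have hφc : ContinuousOn φ T := by
    rw [Metric.continuousOn_iff]
    have huc := Metric.uniformContinuousOn_iff.1
      (hTcpt.uniformContinuousOn_of_continuous hfT)
    intro t ht η hη
    obtain ⟨δ, hδ, h⟩ := huc (η / 4) (by positivity)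
    have key : ∀ u ∈ T, ∀ v ∈ T, u ≤ v → dist u v < δ → dist (φ u) (φ v) < η := by
      intro u hu v hv huv hd
      rw [Real.dist_eq, abs_sub_comm, abs_of_nonneg (sub_nonneg.2 (hφmono u hu v hv huv))]
      have := hWlip (A u) (A v) (η / 4) (hAne u (hTI hu).1) (hAne v (hTI hv).1) (by
        rintro _ ⟨s, ⟨⟨has, hsv⟩, hsT⟩, rfl⟩
        rcases le_or_gt s u with hsu | hsu
        · exact ⟨f s, ⟨s, ⟨⟨has, hsu⟩, hsT⟩, rfl⟩, by rw [dist_self]; positivity⟩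
        · refine ⟨f u, ⟨u, ⟨⟨(hTI hu).1, le_rfl⟩, hu⟩, rfl⟩, (h s hsT u hu ?_).le⟩
          rw [Real.dist_eq] at hd ⊢
          rw [abs_sub_comm, abs_of_nonneg (sub_nonneg.2 huv)] at hd
          rw [abs_of_nonneg (sub_nonneg.2 hsu.le)]
          linarith)
      simp only [φ]
      linarith
    refine ⟨δ, hδ, fun s hs hst => ?_⟩
    rcases le_total s t with h' | h'
    · exact key s hs t ht h' hst
    · rw [dist_comm]
      exact key t ht s hs h' (by rwa [dist_comm])
  have himg : φ '' T = Set.Icc (φ a) (φ b) := by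
    refine Set.Subset.antisymm ?_ ?_
    · rintro _ ⟨u, hu, rfl⟩
      exact ⟨hφmono a haT u hu (hTI hu).1, hφmono u hu b hbT (hTI hu).2⟩
    · intro y hy
      obtain ⟨s, hs⟩ := (hTcpt.of_isClosed_subset
        (hφc.preimage_isClosed_of_isClosed hTc (isClosed_Iic (a := y)))
        Set.inter_subset_left).exists_isGreatest ⟨a, haT, hy.1⟩
      obtain ⟨t, ht⟩ := (hTcpt.of_isClosed_subset
        (hφc.preimage_isClosed_of_isClosed hTc (isClosed_Ici (a := y)))
        Set.inter_subset_left).exists_isLeast ⟨b, hbT, hy.2⟩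
      have hsy : φ s ≤ y := hs.1.2
      have hty : y ≤ φ t := ht.1.2
      rcases le_or_gt t s with h | h
      · exact ⟨t, ht.1.1, le_antisymm ((hφmono t ht.1.1 s hs.1.1 h).trans hsy) hty⟩
      · have hgap : Set.Ioo s t ∩ T = ∅ := by
          rw [Set.eq_empty_iff_forall_notMem]
          rintro u ⟨hu, huT⟩
          rcases le_total (φ u) y with h' | h'
          · exact absurd (hs.2 ⟨huT, h'⟩) (not_le.2 hu.1)
          · exact absurd (ht.2 ⟨huT, h'⟩) (not_le.2 hu.2)
        have := hφeq s hs.1.1 t ht.1.1 h ((hTg s hs.1.1 t ht.1.1 h).2 hgap)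
        exact ⟨t, ht.1.1, le_antisymm (this ▸ hsy) hty⟩
  obtain ⟨g, hgc, hg⟩ := hTcpt.exists_continuousOn_image hφc hfT
    fun s hs t ht => (hφiff s hs t ht).1
  rw [himg] at hgc
  refine ⟨φ a, φ b, g, lt_of_le_of_ne (hφmono a haT b hbT hab)
    fun h => hne ((hφiff a haT b hbT).1 h), hgc, ?_, hg a haT, hg b hbT, ?_⟩
  · rw [← himg]
    rintro _ ⟨u, hu, rfl⟩ _ ⟨v, hv, rfl⟩ h
    rw [hg u hu, hg v hv] at h
    exact (hφiff u hu v hv).2 h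
  · rw [← himg]
    rintro _ ⟨_, ⟨u, hu, rfl⟩, rfl⟩
    exact ⟨u, hTI hu, (hg u hu).symm⟩

/-- The image of a closed interval under a loop injective off the endpoint is a simple closed
curve. -/
theorem isSimpleClosedCurve_image_of_loop {X : Type*} [TopologicalSpace X] [T2Space X] {f : ℝ → X}
    (hf : ContinuousOn f (Set.Icc 0 1)) (h01 : f 0 = f 1) (hinj : Set.InjOn f (Set.Ico 0 1)) :
    IsSimpleClosedCurve (f '' Set.Icc 0 1) := by
  have hc : Continuous (AddCircle.liftIco (1 : ℝ) 0 f) :=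
    AddCircle.liftIco_continuous (by simpa using h01) (by simpa using hf)
  have hval : ∀ x ∈ Set.Ico (0 : ℝ) 1, AddCircle.liftIco (1 : ℝ) 0 f x = f x := fun x hx =>
    AddCircle.liftIco_coe_apply (by simpa using hx)
  have hrep : ∀ y : AddCircle (1 : ℝ), ∃ x ∈ Set.Ico (0 : ℝ) 1, (x : AddCircle (1 : ℝ)) = y := by
    intro y
    have := (AddCircle.equivIco (1 : ℝ) 0).symm_apply_apply y
    refine ⟨AddCircle.equivIco (1 : ℝ) 0 y, ?_, this⟩
    simpa using (AddCircle.equivIco (1 : ℝ) 0 y).2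
  have hmem : ∀ y, AddCircle.liftIco (1 : ℝ) 0 f y ∈ f '' Set.Icc 0 1 := by
    intro y
    obtain ⟨x, hx, rfl⟩ := hrep y
    rw [hval x hx]
    exact ⟨x, ⟨hx.1, hx.2.le⟩, rfl⟩
  let F : AddCircle (1 : ℝ) → f '' Set.Icc 0 1 := fun y => ⟨_, hmem y⟩
  have hF : Function.Bijective F := by
    constructor
    · intro y z h
      obtain ⟨u, hu, rfl⟩ := hrep y
      obtain ⟨v, hv, rfl⟩ := hrep z
      have h' := congrArg Subtype.val h
      simp only [F, hval u hu, hval v hv] at h'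
      rw [hinj hu hv h']
    · rintro ⟨_, x, hx, rfl⟩
      rcases hx.2.lt_or_eq with h | rfl
      · exact ⟨x, Subtype.ext (hval x ⟨hx.1, h⟩)⟩
      · refine ⟨(0 : ℝ), Subtype.ext ((hval 0 ⟨le_rfl, one_pos⟩).trans h01)⟩
  have hFc : Continuous (Equiv.ofBijective F hF) := hc.subtype_mk hmem
  exact ⟨hFc.homeoOfEquivCompactToT2.symm⟩

/-- Two arcs with common endpoints and otherwise disjoint form a simple closed curve. -/
theorem isSimpleClosedCurve_union_of_arcs {X : Type*} [TopologicalSpace X] [T2Space X]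
    {γ δ : ℝ → X} {s t p q : ℝ} (hst : s < t) (hpq : p ≠ q)
    (hγ : ContinuousOn γ (Set.Icc s t)) (hγi : Set.InjOn γ (Set.Icc s t))
    (hδ : ContinuousOn δ (Set.uIcc p q)) (hδi : Set.InjOn δ (Set.uIcc p q))
    (hs : γ s = δ p) (ht : γ t = δ q)
    (hdisj : ∀ u ∈ Set.Ioo s t, ∀ v ∈ Set.uIcc p q, γ u ≠ δ v) :
    IsSimpleClosedCurve (γ '' Set.Icc s t ∪ δ '' Set.uIcc p q) := by
  let a : ℝ → ℝ := fun u => s + 2 * u * (t - s)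
  let b : ℝ → ℝ := fun u => q + (2 * u - 1) * (p - q)
  have hac : Continuous a := by fun_prop
  have hbc : Continuous b := by fun_prop
  have hpq' : p - q ≠ 0 := sub_ne_zero.2 hpq
  have hst' : 0 < t - s := sub_pos.2 hst
  have ha : ∀ u, 0 ≤ u → u ≤ 1 / 2 → a u ∈ Set.Icc s t := by
    intro u h0 h1
    constructor <;> simp only [a] <;> nlinarith
  have hb : ∀ u, 1 / 2 ≤ u → u ≤ 1 → b u ∈ Set.uIcc p q := by
    intro u h0 h1
    rw [Set.uIcc_comm, ← segment_eq_uIcc]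
    refine ⟨2 - 2 * u, 2 * u - 1, by linarith, by linarith, by ring, ?_⟩
    simp only [b, smul_eq_mul]
    ring
  have hainj : Function.Injective a := by
    intro u v h
    simp only [a] at h
    have : (u - v) * (t - s) = 0 := by linarith
    rcases mul_eq_zero.1 this with h | h
    · linarith
    · exact absurd h hst'.ne'
  have hbinj : Function.Injective b := by
    intro u v h
    simp only [b] at h
    have : (u - v) * (p - q) = 0 := by linarith
    rcases mul_eq_zero.1 this with h | h
    · linarith
    · exact absurd h hpq'
  have a0 : a 0 = s := by simp [a]
  have ah : a (1 / 2) = t := by simp [a]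
  have bh : b (1 / 2) = q := by simp [b]
  have b1 : b 1 = p := by simp only [b]; ring
  let f : ℝ → X := fun u => if u ≤ 1 / 2 then γ (a u) else δ (b u)
  have hf1 : ∀ u, u ≤ 1 / 2 → f u = γ (a u) := fun u hu => if_pos hu
  have hf2 : ∀ u, 1 / 2 ≤ u → f u = δ (b u) := by
    intro u hu
    rcases hu.eq_or_lt with rfl | h
    · rw [hf1 _ le_rfl, ah, bh, ht]
    · exact if_neg (not_le.2 h)
  have hsplit : Set.Icc (0 : ℝ) 1 = Set.Icc 0 (1 / 2) ∪ Set.Icc (1 / 2) 1 :=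
    (Set.Icc_union_Icc_eq_Icc (by norm_num) (by norm_num)).symm
  have hfc : ContinuousOn f (Set.Icc 0 1) := by
    rw [hsplit]
    refine ContinuousOn.union_of_isClosed ?_ ?_ isClosed_Icc isClosed_Icc
    · exact (hγ.comp hac.continuousOn fun u hu => ha u hu.1 hu.2).congr fun u hu => hf1 u hu.2
    · exact (hδ.comp hbc.continuousOn fun u hu => hb u hu.1 hu.2).congr fun u hu => hf2 u hu.1
  have h01 : f 0 = f 1 := by
    rw [hf1 0 (by norm_num), hf2 1 (by norm_num), a0, b1, hs]
  have hcross : ∀ u v, 0 ≤ u → u ≤ 1 / 2 → 1 / 2 < v → v < 1 → f u ≠ f v := by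
    intro u v hu0 hu hv hv1 h
    have hbv := hb v hv.le hv1.le
    rw [hf1 u hu, hf2 v hv.le] at h
    rcases hu0.eq_or_lt with rfl | hu0
    · rw [a0, hs] at h
      have := hbinj ((hδi Set.left_mem_uIcc hbv h).symm.trans b1.symm)
      linarith
    · rcases hu.eq_or_lt with rfl | hu
      · rw [ah, ht] at h
        have := hbinj ((hδi Set.right_mem_uIcc hbv h).symm.trans bh.symm)
        linarith
      · refine hdisj (a u) ⟨?_, ?_⟩ _ hbv h <;> simp only [a] <;> nlinarith
  have hinj : Set.InjOn f (Set.Ico 0 1) := by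
    intro u hu v hv h
    rcases le_or_gt u (1 / 2) with hu2 | hu2 <;> rcases le_or_gt v (1 / 2) with hv2 | hv2
    · rw [hf1 u hu2, hf1 v hv2] at h
      exact hainj (hγi (ha u hu.1 hu2) (ha v hv.1 hv2) h)
    · exact absurd h (hcross u v hu.1 hu2 hv2 hv.2)
    · exact absurd h.symm (hcross v u hv.1 hv2 hu2 hu.2)
    · rw [hf2 u hu2.le, hf2 v hv2.le] at h
      exact hbinj (hδi (hb u hu2.le hu.2.le) (hb v hv2.le hv.2.le) h)
  have himg : f '' Set.Icc 0 1 = γ '' Set.Icc s t ∪ δ '' Set.uIcc p q := by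
    refine Set.Subset.antisymm ?_ (Set.union_subset ?_ ?_)
    · rintro _ ⟨u, hu, rfl⟩
      rcases le_total u (1 / 2) with h | h
      · exact Or.inl ⟨a u, ha u hu.1 h, (hf1 u h).symm⟩
      · exact Or.inr ⟨b u, hb u h hu.2, (hf2 u h).symm⟩
    · rintro _ ⟨u, hu, rfl⟩
      have hau : a ((u - s) / (2 * (t - s))) = u := by
        simp only [a]
        field_simp
        ring
      have h1 : (u - s) / (2 * (t - s)) ≤ 1 / 2 := by
        rw [div_le_div_iff₀ (by positivity) (by norm_num)]
        linarith [hu.2]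
      refine ⟨(u - s) / (2 * (t - s)), ⟨?_, by linarith⟩, by rw [hf1 _ h1, hau]⟩
      exact div_nonneg (sub_nonneg.2 hu.1) (by positivity)
    · rintro _ ⟨v, hv, rfl⟩
      rw [Set.uIcc_comm, ← segment_eq_uIcc] at hv
      obtain ⟨x, y, hx, hy, hxy, rfl⟩ := hv
      have hby : b ((1 + y) / 2) = x • q + y • p := by
        simp only [b, smul_eq_mul]
        rw [← eq_sub_iff_add_eq] at hxy
        rw [hxy]
        ring
      refine ⟨(1 + y) / 2, ⟨by linarith, by linarith⟩, ?_⟩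
      rw [hf2 _ (by linarith), hby]
  rw [← himg]
  exact isSimpleClosedCurve_image_of_loop hfc h01 hinj

/-- If the endpoints of an arc `γ` lie on an arc `δ`, then every point of `γ` outside `δ` lies on
a simple closed curve. -/
theorem exists_isSimpleClosedCurve_mem {X : Type*} [TopologicalSpace X] [T2Space X] {γ δ : ℝ → X}
    {a b c d t : ℝ} (hγ : ContinuousOn γ (Set.Icc a b)) (hγi : Set.InjOn γ (Set.Icc a b))
    (hδ : ContinuousOn δ (Set.Icc c d)) (hδi : Set.InjOn δ (Set.Icc c d))
    (ha : γ a ∈ δ '' Set.Icc c d) (hb : γ b ∈ δ '' Set.Icc c d)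
    (ht : t ∈ Set.Icc a b) (htδ : γ t ∉ δ '' Set.Icc c d) :
    ∃ S : Set X, IsSimpleClosedCurve S ∧ γ t ∈ S := by
  have hD : IsClosed (δ '' Set.Icc c d) := (isCompact_Icc.image_of_continuousOn hδ).isClosed
  have hT : IsCompact (Set.Icc a b ∩ γ ⁻¹' (δ '' Set.Icc c d)) :=
    isCompact_Icc.of_isClosed_subset (hγ.preimage_isClosed_of_isClosed isClosed_Icc hD)
      Set.inter_subset_left
  obtain ⟨s, hs⟩ := (hT.inter_right (isClosed_Iic (a := t))).exists_isGreatest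
    ⟨a, ⟨⟨le_rfl, ht.1.trans ht.2⟩, ha⟩, ht.1⟩
  obtain ⟨u, hu⟩ := (hT.inter_right (isClosed_Ici (a := t))).exists_isLeast
    ⟨b, ⟨⟨ht.1.trans ht.2, le_rfl⟩, hb⟩, ht.2⟩
  have hst : s < t := lt_of_le_of_ne hs.1.2 fun h => htδ (h ▸ hs.1.1.2)
  have htu : t < u := lt_of_le_of_ne hu.1.2 fun h => htδ (h ▸ hu.1.1.2)
  obtain ⟨p, hp, hps⟩ := hs.1.1.2
  obtain ⟨q, hq, hqu⟩ := hu.1.1.2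
  have hsub : Set.Icc s u ⊆ Set.Icc a b := Set.Icc_subset_Icc hs.1.1.1.1 hu.1.1.1.2
  have hsub' : Set.uIcc p q ⊆ Set.Icc c d := by
    rw [← segment_eq_uIcc]
    exact (convex_Icc c d).segment_subset hp hq
  refine ⟨_, isSimpleClosedCurve_union_of_arcs (hst.trans htu) ?_ (hγ.mono hsub) (hγi.mono hsub)
    (hδ.mono hsub') (hδi.mono hsub') hps.symm hqu.symm ?_, Or.inl ⟨t, ⟨hst.le, htu.le⟩, rfl⟩⟩
  · rintro rfl
    exact (hst.trans htu).ne (hγi hs.1.1.1 hu.1.1.1 (hps.symm.trans hqu))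
  · intro v hv w hw h
    have hvI := hsub ⟨hv.1.le, hv.2.le⟩
    have hvD : γ v ∈ δ '' Set.Icc c d := ⟨w, hsub' hw, h.symm⟩
    rcases le_total v t with hvt | hvt
    · exact absurd (hs.2 ⟨⟨hvI, hvD⟩, hvt⟩) (not_le.2 hv.1)
    · exact absurd (hu.2 ⟨⟨hvI, hvD⟩, hvt⟩) (not_le.2 hv.2)

/-- If every simple closed curve is contained in `G`, then an arc with endpoints in a closed
connected set `A` runs inside `A ∪ G`. -/
theorem arc_subset_union_of_isPreconnected {X : Type*} [MetricSpace X] [CompactSpace X]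
    [LocallyConnectedSpace X] {G : Set X} (hscc : ∀ S : Set X, IsSimpleClosedCurve S → S ⊆ G)
    {A : Set X} (hA : IsPreconnected A) (hAc : IsClosed A) {γ : ℝ → X} {a b : ℝ} (hab : a < b)
    (hγ : ContinuousOn γ (Set.Icc a b)) (hγi : Set.InjOn γ (Set.Icc a b)) (ha : γ a ∈ A)
    (hb : γ b ∈ A) {t : ℝ} (ht : t ∈ Set.Icc a b) : γ t ∈ A ∪ G := by
  by_contra hcon
  rw [Set.mem_union, not_or] at hcon
  have hpos : 0 < Metric.infDist (γ t) A := (hAc.notMem_iff_infDist_pos ⟨_, ha⟩).1 hcon.1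
  obtain ⟨e, f, he, hf, hf0, hfe, hfA⟩ := exists_path_thickening hA ha hb hpos
  have hne : f 0 ≠ f e := by
    rw [hf0, hfe]
    exact fun h => hab.ne (hγi (Set.left_mem_Icc.2 hab.le) (Set.right_mem_Icc.2 hab.le) h)
  obtain ⟨c, d, δ, hcd, hδ, hδi, hδc, hδd, hsub⟩ := exists_arc_of_path he.le hf hne
  have htδ : γ t ∉ δ '' Set.Icc c d := by
    intro h
    obtain ⟨u, hu, hut⟩ := hsub h
    have := hfA u hu
    rw [hut, Metric.mem_thickening_iff_infDist_lt ⟨_, ha⟩] at this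
    exact lt_irrefl _ this
  obtain ⟨S, hS, htS⟩ := exists_isSimpleClosedCurve_mem hγ hγi hδ hδi
    ⟨c, Set.left_mem_Icc.2 hcd.le, by rw [hδc, hf0]⟩
    ⟨d, Set.right_mem_Icc.2 hcd.le, by rw [hδd, hfe]⟩ ht htδ
  exact hcon.2 (hscc S hS htS)

/-- A nonempty closed connected set containing every simple closed curve. -/
structure IsCore {X : Type*} [TopologicalSpace X] (G : Set X) : Prop where
  isClosed : IsClosed G
  isConnected : IsConnected G
  subset_of_isSimpleClosedCurve : ∀ S : Set X, IsSimpleClosedCurve S → S ⊆ G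

/-- An arc `α : [a, b] → X` that starts at `x` and meets `G` exactly at its other endpoint. -/
structure IsArcInto {X : Type*} [TopologicalSpace X] (G : Set X) (α : ℝ → X) (a b : ℝ)
    (x : X) : Prop where
  lt : a < b
  continuousOn : ContinuousOn α (Set.Icc a b)
  injOn : Set.InjOn α (Set.Icc a b)
  start : α a = x
  mem_iff : ∀ u ∈ Set.Icc a b, (α u ∈ G ↔ u = b)

/-- The smallest closed set containing `G` and `x` among the preconnected ones, given as an
intersection. -/
def coreHull {X : Type*} [TopologicalSpace X] (G : Set X) (x : X) : Set X :=
  ⋂₀ {A | IsClosed A ∧ IsPreconnected A ∧ G ⊆ A ∧ x ∈ A}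

theorem isClosed_coreHull {X : Type*} [TopologicalSpace X] (G : Set X) (x : X) :
    IsClosed (coreHull G x) :=
  isClosed_sInter fun _ hA => hA.1

theorem subset_coreHull {X : Type*} [TopologicalSpace X] (G : Set X) (x : X) :
    G ⊆ coreHull G x :=
  fun _ hy _ hA => hA.2.2.1 hy

theorem mem_coreHull {X : Type*} [TopologicalSpace X] (G : Set X) (x : X) :
    x ∈ coreHull G x :=
  fun _ hA => hA.2.2.2

theorem IsArcInto.drop {X : Type*} [TopologicalSpace X] {G : Set X} {α : ℝ → X} {a b : ℝ} {x : X}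
    (h : IsArcInto G α a b x) {u : ℝ} (hau : a ≤ u) (hub : u < b) : IsArcInto G α u b (α u) :=
  have hsub : Set.Icc u b ⊆ Set.Icc a b := Set.Icc_subset_Icc_left hau
  ⟨hub, h.continuousOn.mono hsub, h.injOn.mono hsub, rfl, fun v hv => h.mem_iff v (hsub hv)⟩

theorem IsArcInto.end_mem {X : Type*} [TopologicalSpace X] {G : Set X} {α : ℝ → X} {a b : ℝ}
    {x : X} (h : IsArcInto G α a b x) : α b ∈ G :=
  (h.mem_iff b (Set.right_mem_Icc.2 h.lt.le)).2 rfl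

theorem IsArcInto.isPreconnected_image {X : Type*} [TopologicalSpace X] {G : Set X} {α : ℝ → X}
    {a b : ℝ} {x : X} (h : IsArcInto G α a b x) : IsPreconnected (α '' Set.Icc a b) :=
  isPreconnected_Icc.image _ h.continuousOn

theorem IsArcInto.start_mem_image {X : Type*} [TopologicalSpace X] {G : Set X} {α : ℝ → X}
    {a b : ℝ} {x : X} (h : IsArcInto G α a b x) : x ∈ α '' Set.Icc a b :=
  ⟨a, Set.left_mem_Icc.2 h.lt.le, h.start⟩

theorem IsArcInto.end_mem_image {X : Type*} [TopologicalSpace X] {G : Set X} {α : ℝ → X}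
    {a b : ℝ} {x : X} (h : IsArcInto G α a b x) : α b ∈ α '' Set.Icc a b :=
  ⟨b, Set.right_mem_Icc.2 h.lt.le, rfl⟩

theorem exists_isArcInto {X : Type*} [MetricSpace X] [CompactSpace X] [LocallyConnectedSpace X]
    {G : Set X} (hG : IsClosed G) {x : X} (hx : x ∉ G) {C : Set X} (hC : IsPreconnected C)
    (hxC : x ∈ C) (hCG : (C ∩ G).Nonempty) {ε : ℝ} (hε : 0 < ε) :
    ∃ (α : ℝ → X) (a b : ℝ), IsArcInto G α a b x ∧
      α '' Set.Icc a b ⊆ Metric.thickening ε C := by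
  obtain ⟨g, hgC, hgG⟩ := hCG
  obtain ⟨e, f, he, hf, hf0, hfe, hfA⟩ := exists_path_thickening hC hxC hgC hε
  have hne : f 0 ≠ f e := by
    rw [hf0, hfe]
    rintro rfl
    exact hx hgG
  obtain ⟨a, d, α, had, hα, hαi, hαa, hαd, hsub⟩ := exists_arc_of_path he.le hf hne
  have hK : IsCompact (Set.Icc a d ∩ α ⁻¹' G) :=
    isCompact_Icc.of_isClosed_subset (hα.preimage_isClosed_of_isClosed isClosed_Icc hG)
      Set.inter_subset_left
  obtain ⟨b, hb⟩ := hK.exists_isLeast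
    ⟨d, Set.right_mem_Icc.2 had.le, by rw [Set.mem_preimage, hαd, hfe]; exact hgG⟩
  have hIcc : Set.Icc a b ⊆ Set.Icc a d := Set.Icc_subset_Icc_right hb.1.1.2
  have hax : α a = x := by rw [hαa, hf0]
  refine ⟨α, a, b, ⟨lt_of_le_of_ne hb.1.1.1 ?_, hα.mono hIcc, hαi.mono hIcc, hax, ?_⟩, ?_⟩
  · rintro rfl
    exact hx (hax ▸ hb.1.2)
  · intro u hu
    refine ⟨fun h => le_antisymm hu.2 (hb.2 ⟨hIcc hu, h⟩), ?_⟩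
    rintro rfl
    exact hb.1.2
  · rintro _ ⟨u, hu, rfl⟩
    obtain ⟨v, hv, hvu⟩ := hsub ⟨u, hIcc hu, rfl⟩
    rw [← hvu]
    exact hfA v hv

theorem IsArcInto.closure_image_Ico {X : Type*} [TopologicalSpace X] {G : Set X} {α : ℝ → X}
    {a b : ℝ} {x : X} (h : IsArcInto G α a b x) : α b ∈ closure (α '' Set.Ico a b) := by
  have hcl : closure (Set.Ico a b) = Set.Icc a b := closure_Ico h.lt.ne
  have hc : ContinuousOn α (closure (Set.Ico a b)) := by
    rw [hcl]
    exact h.continuousOn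
  have hb : b ∈ closure (Set.Ico a b) := by
    rw [hcl]
    exact Set.right_mem_Icc.2 h.lt.le
  exact hc.image_closure (Set.mem_image_of_mem α hb)

theorem IsArcInto.image_diff {X : Type*} [TopologicalSpace X] {G : Set X} {α : ℝ → X}
    {a b : ℝ} {x : X} (h : IsArcInto G α a b x) :
    (G ∪ α '' Set.Icc a b) \ G = α '' Set.Ico a b := by
  ext y
  constructor
  · rintro ⟨hy | ⟨u, hu, rfl⟩, hyG⟩
    · exact absurd hy hyG
    · exact ⟨u, ⟨hu.1, lt_of_le_of_ne hu.2 fun e => hyG ((h.mem_iff u hu).2 e)⟩, rfl⟩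
  · rintro ⟨u, hu, rfl⟩
    have huI : u ∈ Set.Icc a b := ⟨hu.1, hu.2.le⟩
    exact ⟨Or.inr ⟨u, huI, rfl⟩, fun hG => hu.2.ne ((h.mem_iff u huI).1 hG)⟩

theorem IsCore.coreHull_of_mem {X : Type*} [TopologicalSpace X] {G : Set X} (hG : IsCore G)
    {x : X} (hx : x ∈ G) : coreHull G x = G :=
  Set.Subset.antisymm
    (Set.sInter_subset_of_mem ⟨hG.isClosed, hG.isConnected.isPreconnected, subset_rfl, hx⟩)
    (subset_coreHull G x)

theorem IsCore.coreHull_eq {X : Type*} [MetricSpace X] [CompactSpace X] [LocallyConnectedSpace X]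
    {G : Set X} (hG : IsCore G) {x : X} {α : ℝ → X} {a b : ℝ} (h : IsArcInto G α a b x) :
    coreHull G x = G ∪ α '' Set.Icc a b := by
  refine Set.Subset.antisymm (Set.sInter_subset_of_mem ⟨?_, ?_, Set.subset_union_left,
    Or.inr h.start_mem_image⟩) (Set.union_subset (subset_coreHull G x) ?_)
  · exact hG.isClosed.union (isCompact_Icc.image_of_continuousOn h.continuousOn).isClosed
  · exact hG.isConnected.isPreconnected.union (α b) h.end_mem h.end_mem_image
      h.isPreconnected_image
  · rintro _ ⟨u, hu, rfl⟩ A ⟨hAc, hA, hGA, hxA⟩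
    have := arc_subset_union_of_isPreconnected hG.subset_of_isSimpleClosedCurve hA hAc h.lt
      h.continuousOn h.injOn (h.start.symm ▸ hxA) (hGA h.end_mem) hu
    rwa [Set.union_eq_left.2 hGA] at this

theorem IsCore.exists_isArcInto {X : Type*} [MetricSpace X] [CompactSpace X]
    [LocallyConnectedSpace X] [PreconnectedSpace X] {G : Set X} (hG : IsCore G) {x : X}
    (hx : x ∉ G) : ∃ (α : ℝ → X) (a b : ℝ), IsArcInto G α a b x := by
  obtain ⟨α, a, b, h, -⟩ := _root_.exists_isArcInto hG.isClosed hx isPreconnected_univ trivial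
    (by simpa using hG.isConnected.nonempty) one_pos
  exact ⟨α, a, b, h⟩

theorem IsCore.isPreconnected_coreHull {X : Type*} [MetricSpace X] [CompactSpace X]
    [LocallyConnectedSpace X] [PreconnectedSpace X] {G : Set X} (hG : IsCore G) (x : X) :
    IsPreconnected (coreHull G x) := by
  by_cases hx : x ∈ G
  · rw [hG.coreHull_of_mem hx]
    exact hG.isConnected.isPreconnected
  · obtain ⟨α, a, b, h⟩ := hG.exists_isArcInto hx
    rw [hG.coreHull_eq h]
    exact hG.isConnected.isPreconnected.union (α b) h.end_mem h.end_mem_image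
      h.isPreconnected_image

theorem IsCore.coreHull_subset {X : Type*} [MetricSpace X] [CompactSpace X]
    [LocallyConnectedSpace X] [PreconnectedSpace X] {G : Set X} (hG : IsCore G) {x y : X}
    (hy : y ∈ coreHull G x) : coreHull G y ⊆ coreHull G x :=
  Set.sInter_subset_of_mem
    ⟨isClosed_coreHull G x, hG.isPreconnected_coreHull x, subset_coreHull G x, hy⟩

theorem IsCore.coreHull_subset_union {X : Type*} [MetricSpace X] [CompactSpace X]
    [LocallyConnectedSpace X] [PreconnectedSpace X] {G : Set X} (hG : IsCore G) {x y : X}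
    {V : Set X} (hV : IsPreconnected V) (hx : x ∈ V) (hy : y ∈ V) :
    coreHull G y ⊆ coreHull G x ∪ closure V :=
  Set.sInter_subset_of_mem ⟨(isClosed_coreHull G x).union isClosed_closure,
    (hG.isPreconnected_coreHull x).union x (mem_coreHull G x) (subset_closure hx) hV.closure,
    (subset_coreHull G x).trans Set.subset_union_left, Or.inr (subset_closure hy)⟩

theorem IsCore.end_eq {X : Type*} [MetricSpace X] [CompactSpace X] [LocallyConnectedSpace X]
    {G : Set X} (hG : IsCore G) {x : X} {α β : ℝ → X} {a b c d : ℝ} (hα : IsArcInto G α a b x)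
    (hβ : IsArcInto G β c d x) : α b = β d := by
  have h1 : α '' Set.Ico a b = β '' Set.Ico c d := by
    rw [← hα.image_diff, ← hβ.image_diff, ← hG.coreHull_eq hα, ← hG.coreHull_eq hβ]
  have h2 := hα.closure_image_Ico
  rw [h1] at h2
  have h3 : closure (β '' Set.Ico c d) ⊆ β '' Set.Icc c d :=
    closure_minimal (Set.image_mono Set.Ico_subset_Icc_self)
      (isCompact_Icc.image_of_continuousOn hβ.continuousOn).isClosed
  obtain ⟨u, hu, hub⟩ := h3 h2
  have : u = d := (hβ.mem_iff u hu).1 (by rw [hub]; exact hα.end_mem)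
  rw [← hub, this]

/-- The first point retraction onto `G`: it fixes `G` and sends any other point to the endpoint of
the arcs joining it to `G`. -/
structure IsFirstPointMap {X : Type*} [TopologicalSpace X] (G : Set X) (r : X → X) : Prop where
  map_of_mem : ∀ g ∈ G, r g = g
  map_of_isArcInto : ∀ x α a b, IsArcInto G α a b x → r x = α b

theorem IsCore.exists_isFirstPointMap {X : Type*} [MetricSpace X] [CompactSpace X]
    [LocallyConnectedSpace X] [PreconnectedSpace X] {G : Set X} (hG : IsCore G) :
    ∃ r : X → X, IsFirstPointMap G r := by
  classical
  have : ∀ x : X, ∃ y : X, (x ∈ G → y = x) ∧ ∀ α a b, IsArcInto G α a b x → y = α b := by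
    intro x
    by_cases hx : x ∈ G
    · refine ⟨x, fun _ => rfl, fun α a b h => ?_⟩
      have hab := (h.mem_iff a (Set.left_mem_Icc.2 h.lt.le)).1 (h.start.symm ▸ hx)
      exact absurd hab h.lt.ne
    · obtain ⟨α, a, b, h⟩ := hG.exists_isArcInto hx
      exact ⟨α b, fun hx' => absurd hx' hx, fun β c d h' => hG.end_eq h h'⟩
  choose r hr using this
  exact ⟨r, fun g hg => (hr g).1 hg, fun x => (hr x).2⟩

theorem IsFirstPointMap.map_mem {X : Type*} [MetricSpace X] [CompactSpace X]
    [LocallyConnectedSpace X] [PreconnectedSpace X] {G : Set X} (hG : IsCore G) {r : X → X}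
    (hr : IsFirstPointMap G r) (x : X) : r x ∈ G := by
  by_cases hx : x ∈ G
  · rwa [hr.map_of_mem x hx]
  · obtain ⟨α, a, b, h⟩ := hG.exists_isArcInto hx
    rw [hr.map_of_isArcInto x α a b h]
    exact h.end_mem

theorem IsFirstPointMap.mem_closure {X : Type*} [MetricSpace X] [CompactSpace X]
    [LocallyConnectedSpace X] {G : Set X} (hG : IsCore G) {r : X → X}
    (hr : IsFirstPointMap G r) {A : Set X} (hA : IsPreconnected A) {x : X} (hx : x ∈ A)
    (hAG : (A ∩ G).Nonempty) : r x ∈ closure A := by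
  by_cases hxG : x ∈ G
  · rw [hr.map_of_mem x hxG]
    exact subset_closure hx
  · rw [Metric.closure_eq_iInter_thickening]
    refine Set.mem_iInter₂.2 fun ε hε => ?_
    obtain ⟨α, a, b, h, hsub⟩ := exists_isArcInto hG.isClosed hxG hA hx hAG hε
    rw [hr.map_of_isArcInto x α a b h]
    exact hsub h.end_mem_image

theorem closure_subset_closedBall_of_subset_ball {X : Type*} [MetricSpace X] {V : Set X} {x : X}
    {ε : ℝ} (h : V ⊆ Metric.ball x ε) : closure V ⊆ Metric.closedBall x ε :=
  closure_minimal (h.trans Metric.ball_subset_closedBall) Metric.isClosed_closedBall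

theorem IsFirstPointMap.eventually_eq {X : Type*} [MetricSpace X] [CompactSpace X]
    [LocallyConnectedSpace X] [PreconnectedSpace X] {G : Set X} (hG : IsCore G) {r : X → X}
    (hr : IsFirstPointMap G r) {x : X} (hx : x ∉ G) : ∀ᶠ y in 𝓝 x, r y = r x := by
  have hpos : 0 < Metric.infDist x G :=
    (hG.isClosed.notMem_iff_infDist_pos hG.isConnected.nonempty).1 hx
  obtain ⟨V, hVo, hV, hxV, hVb⟩ := exists_isOpen_isPreconnected_subset_ball x (half_pos hpos)
  filter_upwards [hVo.mem_nhds hxV] with y hy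
  obtain ⟨α, a, b, h⟩ := hG.exists_isArcInto hx
  have hA : IsPreconnected (V ∪ α '' Set.Icc a b) :=
    hV.union x hxV h.start_mem_image h.isPreconnected_image
  have hmem := hr.mem_closure hG hA (Or.inl hy) ⟨α b, Or.inr h.end_mem_image, h.end_mem⟩
  rw [closure_union, (isCompact_Icc.image_of_continuousOn h.continuousOn).isClosed.closure_eq]
    at hmem
  have hryG := hr.map_mem hG y
  rcases hmem with hm | ⟨u, hu, hur⟩
  · have h1 := closure_subset_closedBall_of_subset_ball hVb hm
    rw [Metric.mem_closedBall, dist_comm] at h1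
    linarith [Metric.infDist_le_dist_of_mem (x := x) hryG]
  · rw [hr.map_of_isArcInto x α a b h, ← hur, (h.mem_iff u hu).1 (by rwa [hur])]

theorem IsFirstPointMap.continuous {X : Type*} [MetricSpace X] [CompactSpace X]
    [LocallyConnectedSpace X] [PreconnectedSpace X] {G : Set X} (hG : IsCore G) {r : X → X}
    (hr : IsFirstPointMap G r) : Continuous r := by
  rw [continuous_iff_continuousAt]
  intro x
  by_cases hx : x ∈ G
  · rw [Metric.continuousAt_iff']
    intro ε hε
    obtain ⟨V, hVo, hV, hxV, hVb⟩ := exists_isOpen_isPreconnected_subset_ball x (half_pos hε)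
    filter_upwards [hVo.mem_nhds hxV] with y hy
    have := closure_subset_closedBall_of_subset_ball hVb
      (hr.mem_closure hG hV hy ⟨x, hxV, hx⟩)
    rw [Metric.mem_closedBall] at this
    rw [hr.map_of_mem x hx]
    linarith
  · exact (continuousAt_const (y := r x)).congr
      ((hr.eventually_eq hG hx).mono fun y hy => hy.symm)

theorem IsFirstPointMap.eq_of_isPreconnected {X : Type*} [MetricSpace X] [CompactSpace X]
    [LocallyConnectedSpace X] [PreconnectedSpace X] {G : Set X} (hG : IsCore G) {r : X → X}
    (hr : IsFirstPointMap G r) {C : Set X} (hC : IsPreconnected C) (hCG : C ⊆ Gᶜ) {x y : X}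
    (hx : x ∈ C) (hy : y ∈ C) : r x = r y :=
  hC.induction₂ (fun x y => r x = r y)
    (fun _ ha => mem_nhdsWithin_of_mem_nhds
      ((hr.eventually_eq hG (hCG ha)).mono fun _ hb => hb.symm))
    (fun _ _ _ _ _ _ h h' => h.trans h') (fun _ _ _ _ h => h.symm) hx hy

theorem IsFirstPointMap.closure_inter {X : Type*} [MetricSpace X] [CompactSpace X]
    [LocallyConnectedSpace X] [PreconnectedSpace X] {G : Set X} (hG : IsCore G) {r : X → X}
    (hr : IsFirstPointMap G r) {x : X} (hx : x ∉ G) :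
    closure (connectedComponentIn Gᶜ x) ∩ G = {r x} := by
  have hxC : x ∈ connectedComponentIn Gᶜ x := mem_connectedComponentIn hx
  refine Set.Subset.antisymm ?_ ?_
  · rintro g ⟨hg, hgG⟩
    have hcl : closure (connectedComponentIn Gᶜ x) ⊆ {y | r y = r x} :=
      closure_minimal (fun y hy => hr.eq_of_isPreconnected hG isPreconnected_connectedComponentIn
        (connectedComponentIn_subset _ _) hy hxC)
        (isClosed_eq (hr.continuous hG) continuous_const)
    have := hcl hg
    rw [Set.mem_ofPred_eq, hr.map_of_mem g hgG] at this
    exact this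
  · rintro _ rfl
    refine ⟨?_, hr.map_mem hG x⟩
    obtain ⟨α, a, b, h⟩ := hG.exists_isArcInto hx
    rw [hr.map_of_isArcInto x α a b h]
    refine closure_mono ?_ h.closure_image_Ico
    refine (isPreconnected_Ico.image _
      (h.continuousOn.mono Set.Ico_subset_Icc_self)).subset_connectedComponentIn
      ⟨a, Set.left_mem_Ico.2 h.lt, h.start⟩ ?_
    rw [← h.image_diff]
    exact fun y hy => hy.2

theorem IsCore.isClosed_setOf_mem_coreHull {X : Type*} [MetricSpace X] [CompactSpace X]
    [LocallyConnectedSpace X] [PreconnectedSpace X] {G : Set X} (hG : IsCore G) :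
    IsClosed {p : X × X | p.2 ∈ coreHull G p.1} := by
  rw [← isOpen_compl_iff, isOpen_iff_mem_nhds]
  rintro ⟨x, y⟩ hxy
  have hpos : 0 < Metric.infDist y (coreHull G x) :=
    ((isClosed_coreHull G x).notMem_iff_infDist_pos ⟨x, mem_coreHull G x⟩).1 hxy
  obtain ⟨V, hVo, hV, hxV, hVb⟩ := exists_isOpen_isPreconnected_subset_ball x (half_pos hpos)
  filter_upwards [prod_mem_nhds (hVo.mem_nhds hxV) (Metric.ball_mem_nhds y (half_pos hpos))]
  rintro ⟨x', y'⟩ ⟨hx', hy'⟩ hmem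
  rw [Metric.mem_ball, dist_comm] at hy'
  rcases hG.coreHull_subset_union hV hxV hx' hmem with h | h
  · have := Metric.infDist_le_dist_of_mem (x := y) h
    linarith
  · have h1 := closure_subset_closedBall_of_subset_ball hVb h
    rw [Metric.mem_closedBall] at h1
    have h2 := Metric.infDist_le_dist_of_mem (x := y) (mem_coreHull G x)
    linarith [dist_triangle y y' x]

theorem IsCore.continuous_comp_coreHull {X : Type*} [MetricSpace X] [CompactSpace X]
    [LocallyConnectedSpace X] [PreconnectedSpace X] {G : Set X} (hG : IsCore G) {W : Set X → ℝ}
    (hW : ∀ (A B : Set X) (η : ℝ), A.Nonempty → B.Nonempty →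
      (∀ b ∈ B, ∃ a ∈ A, dist b a ≤ η) → W B ≤ W A + 2 * η) :
    Continuous fun x => W (coreHull G x) := by
  rw [continuous_iff_continuousAt]
  intro x
  rw [Metric.continuousAt_iff']
  intro ε hε
  have hδ : 0 < ε / 8 := by positivity
  obtain ⟨V, hVo, hV, hxV, hVb⟩ := exists_isOpen_isPreconnected_subset_ball x hδ
  filter_upwards [hVo.mem_nhds hxV] with y hy
  have hcl := closure_subset_closedBall_of_subset_ball hVb
  have key : ∀ u ∈ V, ∀ v ∈ V, W (coreHull G u) ≤ W (coreHull G v) + 2 * (ε / 8 + ε / 8) := by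
    intro u hu v hv
    refine hW _ _ _ ⟨v, mem_coreHull G v⟩ ⟨u, mem_coreHull G u⟩ fun b hb => ?_
    rcases hG.coreHull_subset_union hV hv hu hb with h | h
    · exact ⟨b, h, by rw [dist_self]; positivity⟩
    · refine ⟨v, mem_coreHull G v, (dist_triangle_right b v x).trans (add_le_add ?_ ?_)⟩
      · exact hcl h
      · exact hcl (subset_closure hv)
  rw [Real.dist_eq, abs_lt]
  constructor <;> linarith [key x hxV y hy, key y hy x hxV]

theorem IsArcInto.strictAntiOn {X : Type*} [MetricSpace X] [CompactSpace X]
    [LocallyConnectedSpace X] [PreconnectedSpace X] {G : Set X} (hG : IsCore G) {W : Set X → ℝ}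
    (hW : ∀ A B : Set X, A.Nonempty → IsClosed A → A ⊆ B → ¬ B ⊆ A → W A < W B)
    {α : ℝ → X} {a b : ℝ} {x : X} (h : IsArcInto G α a b x) :
    StrictAntiOn (fun u => W (coreHull G (α u))) (Set.Icc a b) := by
  intro u hu v hv huv
  have hub : u < b := huv.trans_le hv.2
  have huG : α u ∉ G := fun hcon => hub.ne ((h.mem_iff u hu).1 hcon)
  have hdrop := h.drop hu.1 hub
  refine hW _ _ ⟨_, mem_coreHull G _⟩ (isClosed_coreHull G _) (hG.coreHull_subset ?_) ?_
  · rw [hG.coreHull_eq hdrop]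
    exact Or.inr ⟨v, ⟨huv.le, hv.2⟩, rfl⟩
  · intro hsub
    have hmem := hsub (mem_coreHull G (α u))
    rcases hv.2.eq_or_lt with rfl | hvb
    · rw [hG.coreHull_of_mem h.end_mem] at hmem
      exact huG hmem
    · rw [hG.coreHull_eq (h.drop hv.1 hvb)] at hmem
      rcases hmem with hm | ⟨w, hw, hwu⟩
      · exact huG hm
      · have := h.injOn ⟨hv.1.trans hw.1, hw.2⟩ hu hwu
        linarith [hw.1]

theorem IsFirstPointMap.map_arc {X : Type*} [TopologicalSpace X] {G : Set X} {r : X → X}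
    (hr : IsFirstPointMap G r) {α : ℝ → X} {a b : ℝ} {x : X} (h : IsArcInto G α a b x) {u : ℝ}
    (hu : u ∈ Set.Icc a b) : r (α u) = r x := by
  rw [hr.map_of_isArcInto x α a b h]
  rcases hu.2.eq_or_lt with rfl | hub
  · exact hr.map_of_mem _ h.end_mem
  · exact hr.map_of_isArcInto _ _ _ _ (h.drop hu.1 hub)

theorem IsFirstPointMap.exists_arc_eq {X : Type*} [MetricSpace X] [CompactSpace X]
    [LocallyConnectedSpace X] {G : Set X} (hG : IsCore G) {r : X → X} (hr : IsFirstPointMap G r)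
    {α : ℝ → X} {a b : ℝ} {x y : X} (h : IsArcInto G α a b x) (hy : y ∈ coreHull G x)
    (hry : r y = r x) : ∃ u ∈ Set.Icc a b, α u = y := by
  rw [hG.coreHull_eq h] at hy
  rcases hy with hyG | hy
  · rw [hr.map_of_mem y hyG, hr.map_of_isArcInto x α a b h] at hry
    exact ⟨b, Set.right_mem_Icc.2 h.lt.le, hry.symm⟩
  · exact hy

/-- The first point map onto `G` is a retraction along fibers. -/
theorem IsFirstPointMap.isRetractionAlongFibers {X : Type*} [MetricSpace X] [CompactSpace X]
    [LocallyConnectedSpace X] [PreconnectedSpace X] {G : Set X} (hG : IsCore G) {r : X → X}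
    (hr : IsFirstPointMap G r) : IsRetractionAlongFibers G r := by
  have hrc := hr.continuous hG
  refine ⟨hrc, ?_, hr.map_of_mem, ?_⟩
  · refine Set.Subset.antisymm ?_ fun g hg => ⟨g, hr.map_of_mem g hg⟩
    rintro _ ⟨x, rfl⟩
    exact hr.map_mem hG x
  have : Nonempty X := hG.isConnected.nonempty.to_type
  obtain ⟨W, hWlip, hWstrict⟩ := exists_whitney_map X
  let w : X → ℝ := fun x => W (coreHull G x) - W G
  have hwc : Continuous w := (hG.continuous_comp_coreHull hWlip).sub continuous_const
  have hw0 : ∀ x ∈ G, w x = 0 := fun x hx => by simp only [w, hG.coreHull_of_mem hx, sub_self]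
  have hwanti : ∀ x α a b, IsArcInto G α a b x →
      StrictAntiOn (fun u => w (α u)) (Set.Icc a b) := fun x α a b h u hu v hv huv =>
    sub_lt_sub_right (h.strictAntiOn hG hWstrict hu hv huv) _
  have hexists : ∀ (t : unitInterval) (x : X),
      ∃ y ∈ coreHull G x, r y = r x ∧ w y = (1 - t) * w x := by
    intro t x
    by_cases hx : x ∈ G
    · exact ⟨x, mem_coreHull G x, rfl, by rw [hw0 x hx, mul_zero]⟩
    · obtain ⟨α, a, b, h⟩ := hG.exists_isArcInto hx
      have hab := h.lt.le
      have hwb : w (α b) = 0 := hw0 _ h.end_mem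
      have hwx : 0 < w x := by
        have := hwanti x α a b h (Set.left_mem_Icc.2 hab) (Set.right_mem_Icc.2 hab) h.lt
        simpa only [h.start, hwb] using this
      have hivt := intermediate_value_Icc' hab (hwc.comp_continuousOn h.continuousOn)
      have hmem : (1 - (t : ℝ)) * w x ∈ Set.Icc (w (α b)) (w (α a)) := by
        rw [hwb, h.start]
        constructor <;> nlinarith [t.2.1, t.2.2]
      obtain ⟨u, hu, huw⟩ := hivt hmem
      refine ⟨α u, ?_, hr.map_arc h hu, huw⟩
      rw [hG.coreHull_eq h]
      exact Or.inr ⟨u, hu, rfl⟩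
  have hunique : ∀ x, ∀ y ∈ coreHull G x, ∀ y' ∈ coreHull G x, r y = r x → r y' = r x →
      w y = w y' → y = y' := by
    intro x y hy y' hy' hry hry' hww
    by_cases hx : x ∈ G
    · rw [hG.coreHull_of_mem hx] at hy hy'
      rw [← hr.map_of_mem y hy, ← hr.map_of_mem y' hy', hry, hry']
    · obtain ⟨α, a, b, h⟩ := hG.exists_isArcInto hx
      obtain ⟨u, hu, rfl⟩ := hr.exists_arc_eq hG h hy hry
      obtain ⟨u', hu', rfl⟩ := hr.exists_arc_eq hG h hy' hry'
      rw [(hwanti x α a b h).injOn hu hu' hww]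
  let Γ : Set (unitInterval × X × X) :=
    {p | p.2.2 ∈ coreHull G p.2.1 ∧ r p.2.2 = r p.2.1 ∧ w p.2.2 = (1 - p.1) * w p.2.1}
  have hΓ : IsCompact Γ := by
    refine IsClosed.isCompact ((hG.isClosed_setOf_mem_coreHull.preimage continuous_snd).inter
      ((isClosed_eq ?_ ?_).inter (isClosed_eq ?_ ?_))) <;> fun_prop
  obtain ⟨h, hc, hh⟩ := hΓ.exists_continuousOn_image
    (φ := fun p => (p.1, p.2.1)) (f := fun p => p.2.2) (by fun_prop) (by fun_prop) (by
      rintro ⟨t, x, y⟩ ⟨hy, hry, hwy⟩ ⟨t', x', y'⟩ ⟨hy', hry', hwy'⟩ heq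
      obtain ⟨rfl, rfl⟩ := Prod.mk.inj heq
      exact hunique x y hy y' hy' hry hry' (hwy.trans hwy'.symm))
  have hspec : ∀ t x, h (t, x) ∈ coreHull G x ∧ r (h (t, x)) = r x ∧
      w (h (t, x)) = (1 - t) * w x := by
    intro t x
    obtain ⟨y, hy⟩ := hexists t x
    have : h (t, x) = y := hh (t, x, y) hy
    rw [this]
    exact hy
  have himg : (fun p : unitInterval × X × X => (p.1, p.2.1)) '' Γ = Set.univ := by
    refine Set.eq_univ_of_forall ?_
    rintro ⟨t, x⟩
    obtain ⟨y, hy⟩ := hexists t x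
    exact ⟨(t, x, y), hy, rfl⟩
  rw [himg, continuousOn_univ] at hc
  have hrG : ∀ x, r x ∈ coreHull G x := fun x => subset_coreHull G x (hr.map_mem hG x)
  have hrr : ∀ x, r (r x) = r x := fun x => hr.map_of_mem _ (hr.map_mem hG x)
  refine ⟨h, hc, fun x => ?_, fun x => ?_, fun t x => (hspec t x).2.1⟩
  · obtain ⟨h1, h2, h3⟩ := hspec 0 x
    exact hunique x _ h1 x (mem_coreHull G x) h2 rfl (by simpa using h3)
  · obtain ⟨h1, h2, h3⟩ := hspec 1 x
    exact hunique x _ h1 _ (hrG x) h2 (hrr x) (by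
      rw [h3, hw0 _ (hr.map_mem hG x)]
      simp)

/-- Every retraction along fibers is the first point map. -/
theorem IsRetractionAlongFibers.eq_of_isFirstPointMap {X : Type*} [MetricSpace X] [CompactSpace X]
    [LocallyConnectedSpace X] [PreconnectedSpace X] {G : Set X} (hG : IsCore G) {r r' : X → X}
    (hr : IsFirstPointMap G r) (hr' : IsRetractionAlongFibers G r') : r' = r := by
  obtain ⟨-, hrange, hfix, h, hc, h0, h1, hfib⟩ := hr'
  funext x
  by_cases hx : x ∈ G
  · rw [hfix x hx, hr.map_of_mem x hx]
  have hp : Continuous fun t => h (t, x) := by fun_prop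
  obtain ⟨t, ht⟩ := (hG.isClosed.preimage hp).isCompact.exists_isLeast
    ⟨1, by rw [Set.mem_preimage, h1, ← hrange]; exact ⟨x, rfl⟩⟩
  have htG : h (t, x) ∈ G := ht.1
  have hpos : 0 < t := by
    refine lt_of_le_of_ne t.2.1 ?_
    rintro rfl
    exact hx (h0 x ▸ htG)
  have hsub : (fun t => h (t, x)) '' Set.Iio t ⊆ connectedComponentIn Gᶜ x := by
    refine (isPreconnected_Iio.image _ hp.continuousOn).subset_connectedComponentIn
      ⟨0, hpos, h0 x⟩ ?_
    rintro _ ⟨s, hs, rfl⟩ hsG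
    exact absurd (ht.2 hsG) (not_le.2 hs)
  have hcl : h (t, x) ∈ closure (connectedComponentIn Gᶜ x) := by
    refine closure_mono hsub (image_closure_subset_closure_image hp ⟨t, ?_, rfl⟩)
    rw [closure_Iio' (a := t) (⟨0, hpos⟩ : (Set.Iio t).Nonempty)]
    exact Set.mem_Iic.2 le_rfl
  have hmem : h (t, x) ∈ closure (connectedComponentIn Gᶜ x) ∩ G := ⟨hcl, htG⟩
  rw [hr.closure_inter hG hx] at hmem
  rw [← hfib t x, hfix _ htG]
  exact hmem

theorem IsLocalDendrite.locallyConnectedSpace {X : Type*} [TopologicalSpace X]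
    (hX : IsLocalDendrite X) : LocallyConnectedSpace X := by
  rw [locallyConnectedSpace_iff_connected_subsets]
  intro x U hU
  obtain ⟨N, hN, -, hloc, -⟩ := hX.2 x
  have hxN : x ∈ N := mem_of_mem_nhds hN
  have hU' : ((↑) : N → X) ⁻¹' U ∈ 𝓝 (⟨x, hxN⟩ : N) :=
    continuous_subtype_val.continuousAt.preimage_mem_nhds hU
  obtain ⟨V, hV, hVc, hVU⟩ := locallyConnectedSpace_iff_connected_subsets.1 hloc _ _ hU'
  refine ⟨(↑) '' V, ?_, hVc.image _ continuous_subtype_val.continuousOn, by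
    rintro _ ⟨y, hy, rfl⟩; exact hVU hy⟩
  have := Filter.image_mem_map (m := ((↑) : N → X)) hV
  rwa [map_nhds_subtype_coe_eq_nhds hxN hN] at this

/-- If `G` is a subcontinuum of a local dendrite `X` containing every simple
closed curve, then there is a retraction `r : X → G` with a homotopy moving points only
along the fibers of `r`; moreover such `r` is unique, characterized by mapping each
connected component `C` of `X ∖ G` to the unique point of `closure C ∩ G`. -/
theorem exists_unique_retraction_along_fibers
    {X : Type u} [TopologicalSpace X] (hX : IsLocalDendrite X)
    (G : Set X) (hG : IsContinuum G)
    (hscc : ∀ S : Set X, IsSimpleClosedCurve S → S ⊆ G) :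
    (∃ r : X → X, IsRetractionAlongFibers G r) ∧
    (∀ r r' : X → X, IsRetractionAlongFibers G r → IsRetractionAlongFibers G r' →
      r = r') ∧
    (∀ r : X → X, IsRetractionAlongFibers G r ↔
      ((∀ g ∈ G, r g = g) ∧
        ∀ x : X, x ∉ G → closure (connectedComponentIn Gᶜ x) ∩ G = {r x})) := by
  have hloc := hX.locallyConnectedSpace
  obtain ⟨⟨-, hcpt, hconn, hmet⟩, -⟩ := hX
  let _ : MetricSpace X := TopologicalSpace.metrizableSpaceMetric X
  have hcore : IsCore G :=
    ⟨(isCompact_iff_compactSpace.2 hG.2.1).isClosed, isConnected_iff_connectedSpace.2 hG.2.2.1,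
      hscc⟩
  obtain ⟨r, hr⟩ := hcore.exists_isFirstPointMap
  have hrr := hr.isRetractionAlongFibers hcore
  refine ⟨⟨r, hrr⟩, fun r₁ r₂ h₁ h₂ => ?_, fun r' => ⟨?_, ?_⟩⟩
  · rw [h₁.eq_of_isFirstPointMap hcore hr, h₂.eq_of_isFirstPointMap hcore hr]
  · intro h
    rw [h.eq_of_isFirstPointMap hcore hr]
    exact ⟨hr.map_of_mem, fun x hx => hr.closure_inter hcore hx⟩
  · rintro ⟨hfix, hcl⟩
    have : r' = r := by
      funext x
      by_cases hx : x ∈ G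
      · rw [hfix x hx, hr.map_of_mem x hx]
      · have := hcl x hx
        rw [hr.closure_inter hcore hx] at this
        exact (Set.singleton_injective this).symm
    rw [this]
    exact hrr
end

section
/- Let G be a local dendrite, let S ⊆ G be a countable subset, and for each g ∈ S let (D_g, d_g) be a pointed dendrite. Then there exists a local dendrite X containing G as a subcontinuum such that G contains every simple closed curve of X, and such that the canonical retraction r : X → G satisfies: for each g ∈ S there is a homeomorphism from r⁻¹(g) to D_g sending g to d_g, and r⁻¹(g) = {g} for each g ∈ G ∖ S. -/
open Topology

/-- The canonical retraction of `X` onto `G`: the identity on `G`, sending each connected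
component `C` of `X ∖ G` to the unique point of `closure C ∩ G`. -/
def IsCanonicalRetraction {X : Type*} [TopologicalSpace X] (G : Set X) (r : X → X) :
    Prop :=
  (∀ g ∈ G, r g = g) ∧
  ∀ x : X, x ∉ G → r x ∈ G ∧ closure (connectedComponentIn Gᶜ x) ∩ G = {r x}

open Set

section Topology

variable {X Y : Type*} [TopologicalSpace X] [TopologicalSpace Y]

theorem AddCircle.isPreconnected_compl_singleton (a : AddCircle (1 : ℝ)) :
    IsPreconnected ({a}ᶜ : Set (AddCircle (1 : ℝ))) := by
  have : Fact ((0 : ℝ) < 1) := ⟨one_pos⟩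
  obtain ⟨t, rfl⟩ := QuotientAddGroup.mk_surjective a
  have himage : ({(t : AddCircle (1 : ℝ))}ᶜ : Set (AddCircle (1 : ℝ))) =
      (fun x : ℝ ↦ (x : AddCircle (1 : ℝ))) '' Ioo t (t + 1) := by
    ext b
    constructor
    · intro hb
      have hmem : b ∈ (fun x : ℝ ↦ (x : AddCircle (1 : ℝ))) '' Ico t (t + 1) := by
        rw [AddCircle.coe_image_Ico_eq]
        trivial
      obtain ⟨x, hx, rfl⟩ := hmem
      refine ⟨x, ⟨lt_of_le_of_ne hx.1 ?_, hx.2⟩, rfl⟩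
      rintro rfl
      exact hb rfl
    · rintro ⟨x, hx, rfl⟩ hxt
      have := (AddCircle.coe_eq_coe_iff_of_mem_Ico (p := (1 : ℝ)) (a := t)
        ⟨hx.1.le, hx.2⟩ ⟨le_rfl, by linarith⟩).1 hxt
      exact hx.1.ne' this
  exact himage ▸ isPreconnected_Ioo.image _ (AddCircle.continuous_mk' 1).continuousOn

theorem IsSimpleClosedCurve.isPreconnected_diff_singleton {C : Set X}
    (hC : IsSimpleClosedCurve C) (q : X) : IsPreconnected (C \ {q}) := by
  obtain ⟨h⟩ := hC
  have hcont : Continuous fun a ↦ (h.symm a : X) := by fun_prop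
  by_cases hq : q ∈ C
  · have himage : C \ {q} = (fun a ↦ (h.symm a : X)) '' {h ⟨q, hq⟩}ᶜ := by
      ext x
      constructor
      · rintro ⟨hx, hxq⟩
        refine ⟨h ⟨x, hx⟩, fun he ↦ hxq ?_, by simp⟩
        exact congrArg Subtype.val (h.injective he)
      · rintro ⟨a, ha, rfl⟩
        refine ⟨(h.symm a).2, fun he ↦ ha ?_⟩
        have : h.symm a = ⟨q, hq⟩ := Subtype.ext he
        simp [← this]
    exact himage ▸ (AddCircle.isPreconnected_compl_singleton _).image _ hcont.continuousOn
  · have : Fact ((0 : ℝ) < 1) := ⟨one_pos⟩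
    have hrange : C \ {q} = range fun a ↦ (h.symm a : X) := by
      rw [sdiff_singleton_eq_self hq]
      exact (h.symm.surjective.range_comp Subtype.val).trans Subtype.range_coe |>.symm
    exact hrange ▸ isPreconnected_range hcont

theorem Topology.IsEmbedding.isSimpleClosedCurve_image_iff {f : X → Y} (hf : IsEmbedding f)
    {C : Set X} : IsSimpleClosedCurve (f '' C) ↔ IsSimpleClosedCurve C :=
  ⟨fun ⟨h⟩ ↦ ⟨(hf.homeomorphImage C).trans h⟩, fun ⟨h⟩ ↦ ⟨(hf.homeomorphImage C).symm.trans h⟩⟩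

theorem Topology.IsEmbedding.isSimpleClosedCurve_preimage {f : X → Y} (hf : IsEmbedding f)
    {C : Set Y} (hC : IsSimpleClosedCurve C) (hsub : C ⊆ range f) :
    IsSimpleClosedCurve (f ⁻¹' C) := by
  rw [← hf.isSimpleClosedCurve_image_iff, image_preimage_eq_of_subset hsub]
  exact hC

theorem locallyConnectedSpace_coe_iff {T : Set X} :
    LocallyConnectedSpace T ↔
      ∀ z ∈ T, ∀ U ∈ 𝓝 z, ∃ V ∈ 𝓝[T] z, IsPreconnected V ∧ V ⊆ U ∩ T := by
  rw [locallyConnectedSpace_iff_connected_subsets]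
  constructor
  · intro h z hz U hU
    obtain ⟨V, hV, hVc, hVU⟩ := h ⟨z, hz⟩ (Subtype.val ⁻¹' U) (preimage_coe_mem_nhds_subtype.2
      (mem_nhdsWithin_of_mem_nhds hU))
    refine ⟨Subtype.val '' V, ?_, hVc.image _ continuous_subtype_val.continuousOn, ?_⟩
    · rw [← map_nhds_subtype_val ⟨z, hz⟩]
      exact Filter.image_mem_map hV
    · rintro _ ⟨v, hv, rfl⟩
      exact ⟨hVU hv, v.2⟩
  · rintro h ⟨z, hz⟩ U hU
    obtain ⟨U', hU', hsub⟩ := (mem_nhds_subtype T ⟨z, hz⟩ U).1 hU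
    obtain ⟨V, hV, hVc, hVU⟩ := h z hz U' hU'
    refine ⟨Subtype.val ⁻¹' V, preimage_coe_mem_nhds_subtype.2 hV, ?_,
      fun v hv ↦ hsub (hVU hv).1⟩
    rw [← IsInducing.subtypeVal.isPreconnected_image, Subtype.image_preimage_coe,
      inter_eq_self_of_subset_right fun v hv ↦ (hVU hv).2]
    exact hVc

/-- In a connected, locally connected space, every component of the complement of a point
accumulates at that point. -/
theorem mem_closure_connectedComponentIn_compl_singleton [T1Space X] [PreconnectedSpace X]
    [LocallyConnectedSpace X] {a x : X} (hx : x ≠ a) :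
    a ∈ closure (connectedComponentIn {a}ᶜ x) := by
  set K := connectedComponentIn ({a}ᶜ : Set X) x
  by_contra ha
  have hsub : K ⊆ {a}ᶜ := connectedComponentIn_subset _ _
  have hclosed : closure K ⊆ K :=
    isPreconnected_connectedComponentIn.closure.subset_connectedComponentIn
      (subset_closure (mem_connectedComponentIn hx)) fun y hy hya ↦ ha (hya ▸ hy)
  have hclopen : IsClopen K :=
    ⟨isClosed_of_closure_subset hclosed, isOpen_compl_singleton.connectedComponentIn⟩
  have huniv := hclopen.eq_univ ⟨x, mem_connectedComponentIn hx⟩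
  exact hsub (huniv ▸ mem_univ a) rfl

end Topology

/-- The space obtained from `G` by attaching `D g` at each `g ∈ S`, the point `d g` being
identified with `g`. It is realised inside `G × ∏ g, D g`, each `D g` being attached as a set
of points all of whose other coordinates are base points. -/
abbrev Attach {G : Type*} {S : Set G} {D : S → Type*} (d : ∀ g : S, D g) :=
  {z : G × (∀ g : S, D g) // ∀ g : S, z.1 ≠ g → z.2 g = d g}

namespace Attach

variable {G : Type*} {S : Set G} {D : S → Type*} {d : ∀ g : S, D g}

/-- The projection onto the base. -/
def proj (z : Attach d) : G := z.1.1

/-- The inclusion of the base. -/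
def base (d : ∀ g : S, D g) (x : G) : Attach d := ⟨(x, d), fun _ _ ↦ rfl⟩

open Classical in
/-- The inclusion of the attached space at `g`. -/
noncomputable def fiber (d : ∀ g : S, D g) (g : S) (y : D g) : Attach d :=
  ⟨(g, Function.update d g y), fun _ hne ↦
    Function.update_of_ne (fun he ↦ hne (congrArg Subtype.val he.symm)) _ _⟩

theorem proj_base (x : G) : proj (base d x) = x := rfl

theorem coord_fiber (g : S) (y : D g) : (fiber d g y).1.2 g = y := by
  simp [fiber]

theorem fiber_self (g : S) : fiber d g (d g) = base d g := by
  simp [fiber, base]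

theorem fiber_coord {g : S} {z : Attach d} (hz : proj z = g) : fiber d g (z.1.2 g) = z := by
  refine Subtype.ext (Prod.ext hz.symm ?_)
  funext h
  by_cases hh : h = g
  · subst hh
    exact coord_fiber _ _
  · have hne : (g : G) ≠ h := fun he ↦ hh (Subtype.ext he.symm)
    exact ((fiber d g (z.1.2 g)).2 h hne).trans (z.2 h fun he ↦ hne (hz.symm.trans he)).symm

theorem base_proj_of_notMem {z : Attach d} (hz : proj z ∉ S) : base d (proj z) = z := by
  refine Subtype.ext (Prod.ext rfl ?_)
  funext g
  exact (z.2 g fun he ↦ hz (show z.1.1 ∈ S from he ▸ g.2)).symm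

theorem base_proj_of_coord_eq {g : S} {z : Attach d} (hz : proj z = g) (h : z.1.2 g = d g) :
    base d (proj z) = z := by
  rw [hz, ← fiber_self, ← h, fiber_coord hz]

theorem proj_eq_of_coord_ne {g : S} {z : Attach d} (h : z.1.2 g ≠ d g) : proj z = g :=
  by_contra fun hne ↦ h (z.2 g hne)

theorem exists_coord_ne {z : Attach d} (hz : z ∉ range (base d)) : ∃ g : S, z.1.2 g ≠ d g := by
  by_contra! h
  exact hz ⟨proj z, Subtype.ext (Prod.ext rfl (funext fun g ↦ (h g).symm))⟩

variable [TopologicalSpace G] [∀ g, TopologicalSpace (D g)]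

theorem continuous_proj : Continuous (proj : Attach d → G) :=
  continuous_fst.comp continuous_subtype_val

theorem continuous_coord (g : S) : Continuous fun z : Attach d ↦ z.1.2 g :=
  (continuous_apply g).comp (continuous_snd.comp continuous_subtype_val)

theorem continuous_base : Continuous (base d) :=
  Continuous.subtype_mk (continuous_id.prodMk continuous_const) _

theorem continuous_fiber (g : S) : Continuous (fiber d g) := by
  classical
  exact Continuous.subtype_mk (continuous_const.prodMk
    (continuous_const.update g continuous_id)) _

theorem isEmbedding_base : IsEmbedding (base d) :=
  Function.LeftInverse.isEmbedding (f := proj) proj_base continuous_proj continuous_base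

theorem isEmbedding_fiber (g : S) : IsEmbedding (fiber d g) :=
  Function.LeftInverse.isEmbedding (f := fun z : Attach d ↦ z.1.2 g) (coord_fiber g)
    (continuous_coord g) (continuous_fiber g)

/-- The fiber of the projection over `g ∈ S` is the space attached at `g`. -/
noncomputable def fiberHomeomorph (d : ∀ g : S, D g) (g : S) :
    {z : Attach d // proj z = g} ≃ₜ D g where
  toFun z := z.1.1.2 g
  invFun y := ⟨fiber d g y, rfl⟩
  left_inv z := Subtype.ext (fiber_coord z.2)
  right_inv := coord_fiber g
  continuous_toFun := (continuous_coord g).comp continuous_subtype_val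
  continuous_invFun := (continuous_fiber g).subtype_mk _

theorem isClosed_carrier [T2Space G] [∀ g, T1Space (D g)] (d : ∀ g : S, D g) :
    IsClosed {z : G × (∀ g : S, D g) | ∀ g : S, z.1 ≠ g → z.2 g = d g} := by
  simp only [ofPred_forall]
  refine isClosed_iInter fun g ↦ ?_
  have h : {z : G × (∀ g : S, D g) | z.1 ≠ g → z.2 g = d g} =
      {z | z.1 = (g : G)} ∪ {z | z.2 g = d g} := by
    ext z
    simp only [mem_ofPred_eq, mem_union]
    tauto
  rw [h]
  exact (isClosed_singleton.preimage continuous_fst).union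
    (isClosed_singleton.preimage ((continuous_apply g).comp continuous_snd))

theorem compactSpace [T2Space G] [CompactSpace G] [∀ g, T1Space (D g)]
    [∀ g, CompactSpace (D g)] : CompactSpace (Attach d) :=
  isCompact_iff_compactSpace.1 (isClosed_carrier d).isCompact

theorem metrizableSpace [Countable S] [TopologicalSpace.MetrizableSpace G]
    [∀ g, TopologicalSpace.MetrizableSpace (D g)] :
    TopologicalSpace.MetrizableSpace (Attach d) := by
  have : Encodable S := Encodable.ofCountable S
  let _ (g : S) : MetricSpace (D g) := TopologicalSpace.metrizableSpaceMetric (D g)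
  have : TopologicalSpace.MetrizableSpace (∀ g, D g) :=
    let := PiCountable.metricSpace (F := D)
    inferInstance
  exact IsEmbedding.subtypeVal.metrizableSpace

theorem isPreconnected_of_fibers {A : Set (Attach d)} {V : Set G} (hV : IsPreconnected V)
    (hVA : base d '' V ⊆ A) (hAV : ∀ z ∈ A, proj z ∈ V)
    (hfib : ∀ g : S, IsPreconnected (fiber d g ⁻¹' A)) : IsPreconnected A := by
  have hbase : IsPreconnected (base d '' V) := hV.image _ continuous_base.continuousOn
  rcases V.eq_empty_or_nonempty with rfl | ⟨x, hx⟩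
  · rw [eq_empty_of_forall_notMem hAV]
    exact isPreconnected_empty
  refine isPreconnected_of_forall (base d x) fun z hz ↦ ?_
  by_cases hzS : proj z ∈ S
  · let g : S := ⟨proj z, hzS⟩
    refine ⟨base d '' V ∪ fiber d g '' (fiber d g ⁻¹' A),
      union_subset hVA (image_preimage_subset _ _), Or.inl ⟨x, hx, rfl⟩,
      Or.inr ⟨z.1.2 g, ?_, fiber_coord rfl⟩, ?_⟩
    · rw [mem_preimage, fiber_coord rfl]
      exact hz
    · refine IsPreconnected.union (base d g) ⟨g, hAV z hz, rfl⟩ ⟨d g, ?_, fiber_self g⟩ hbase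
        ((hfib g).image _ (continuous_fiber g).continuousOn)
      rw [mem_preimage, fiber_self]
      exact hVA ⟨g, hAV z hz, rfl⟩
  · refine ⟨base d '' V, hVA, ⟨x, hx, rfl⟩, ⟨proj z, hAV z hz, base_proj_of_notMem hzS⟩, hbase⟩

theorem isPreconnected_preimage_proj [∀ g, PreconnectedSpace (D g)] {N : Set G}
    (hN : IsPreconnected N) : IsPreconnected (proj ⁻¹' N : Set (Attach d)) := by
  refine isPreconnected_of_fibers hN ?_ (fun _ hz ↦ hz) fun g ↦ ?_
  · rintro _ ⟨x, hx, rfl⟩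
    exact hx
  · by_cases hg : (g : G) ∈ N
    · have : fiber d g ⁻¹' (proj ⁻¹' N) = univ := eq_univ_of_forall fun _ ↦ hg
      exact this ▸ isPreconnected_univ
    · have : fiber d g ⁻¹' (proj ⁻¹' N) = ∅ := eq_empty_of_forall_notMem fun _ h ↦ hg h
      exact this ▸ isPreconnected_empty

theorem isOpen_coord_ne [∀ g, T1Space (D g)] (g : S) :
    IsOpen {z : Attach d | z.1.2 g ≠ d g} :=
  isOpen_compl_singleton.preimage (continuous_coord g)

/-- Small neighbourhoods of a point of the base are controlled by a neighbourhood in the base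
and one in the space attached at that point. -/
theorem exists_nhds_base [T1Space G] {x : G} {U : Set (Attach d)} (hU : U ∈ 𝓝 (base d x)) :
    ∃ V ∈ 𝓝 x, ∃ W : ∀ g : S, Set (D g), (∀ g, W g ∈ 𝓝 (d g)) ∧
      ∀ z : Attach d, proj z ∈ V → (∀ g : S, x = g → z.1.2 g ∈ W g) → z ∈ U := by
  classical
  obtain ⟨U', hU', hsub⟩ := (mem_nhds_subtype _ _ _).1 hU
  obtain ⟨V, hV, P, hP, hVP⟩ := mem_nhds_prod_iff.1 hU'
  change P ∈ 𝓝 d at hP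
  rw [nhds_pi, Filter.mem_pi] at hP
  obtain ⟨I, hI, W, hW, hWP⟩ := hP
  refine ⟨V ∩ ⋂ g ∈ I, {y | y = g → x = g}, Filter.inter_mem hV ?_, W, hW, ?_⟩
  · refine (Filter.biInter_mem hI).2 fun g _ ↦ ?_
    by_cases hx : x = g
    · simp [hx]
    · filter_upwards [isOpen_ne.mem_nhds hx] with y hy hyg using absurd hyg hy
  · rintro z ⟨hzV, hzI⟩ hzW
    refine hsub (hVP ⟨hzV, hWP fun g hg ↦ ?_⟩)
    by_cases hx : x = g
    · exact hzW g hx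
    · have hne : proj z ≠ g := fun he ↦ hx (mem_iInter₂.1 hzI g hg he)
      rw [z.2 g hne]
      exact mem_of_mem_nhds (hW g)

theorem locallyConnectedSpace_preimage_proj [T1Space G] [∀ g, T1Space (D g)]
    [∀ g, PreconnectedSpace (D g)] [∀ g, LocallyConnectedSpace (D g)] {N : Set G}
    (hN : LocallyConnectedSpace N) :
    LocallyConnectedSpace (proj ⁻¹' N : Set (Attach d)) := by
  rw [locallyConnectedSpace_coe_iff] at hN ⊢
  intro z hz U hU
  by_cases hzb : z ∈ range (base d)
  · obtain ⟨x, rfl⟩ := hzb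
    obtain ⟨V, hV, W, hW, hVW⟩ := exists_nhds_base hU
    obtain ⟨V', hV', hV'c, hV'V⟩ := hN x hz V hV
    choose W' hW' hW'c hW'W using fun g ↦
      locallyConnectedSpace_iff_connected_subsets.1 inferInstance (d g) (W g) (hW g)
    refine ⟨{z | proj z ∈ V' ∧ ∀ g : S, x = g → z.1.2 g ∈ W' g}, ?_, ?_, ?_⟩
    · have hproj : proj ⁻¹' V' ∈ 𝓝[proj ⁻¹' N] (base d x) :=
        (continuous_proj.continuousWithinAt.tendsto_nhdsWithin fun _ h ↦ h) hV'
      refine Filter.inter_mem hproj (mem_nhdsWithin_of_mem_nhds ?_)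
      by_cases hx : x ∈ S
      · filter_upwards [(continuous_coord (d := d) ⟨x, hx⟩).continuousAt.preimage_mem_nhds
          (x := base d x) (hW' ⟨x, hx⟩)] with y hy g hg
        obtain rfl : g = ⟨x, hx⟩ := Subtype.ext hg.symm
        exact hy
      · exact Filter.univ_mem' fun y g hg ↦ absurd (hg ▸ g.2) hx
    · refine isPreconnected_of_fibers hV'c ?_ (fun z hz ↦ hz.1) fun g ↦ ?_
      · rintro _ ⟨y, hy, rfl⟩
        exact ⟨hy, fun g _ ↦ mem_of_mem_nhds (hW' g)⟩
      · by_cases hg : (g : G) ∈ V'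
        · by_cases hx : x = g
          · convert hW'c g using 1
            ext y
            constructor
            · intro hy
              simpa only [coord_fiber] using hy.2 g hx
            · intro hy
              refine ⟨hg, fun h hh ↦ ?_⟩
              obtain rfl : h = g := Subtype.ext (hh.symm.trans hx)
              rwa [coord_fiber]
          · convert isPreconnected_univ (α := D g) using 1
            refine eq_univ_of_forall fun y ↦ ⟨hg, fun h hh ↦ ?_⟩
            rw [(fiber d g y).2 h fun he ↦ hx (hh.trans he.symm)]
            exact mem_of_mem_nhds (hW' h)
        · convert isPreconnected_empty (α := D g) using 1
          exact eq_empty_of_forall_notMem fun y hy ↦ hg hy.1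
    · exact fun z hz ↦ ⟨hVW z (hV'V hz.1).1 fun g hg ↦ hW'W g (hz.2 g hg), (hV'V hz.1).2⟩
  · obtain ⟨g, hg⟩ := exists_coord_ne hzb
    have hpz := proj_eq_of_coord_ne hg
    have hnhds : fiber d g ⁻¹' U ∈ 𝓝 (z.1.2 g) :=
      (continuous_fiber g).continuousAt.preimage_mem_nhds (by rwa [fiber_coord hpz])
    obtain ⟨W, hW, hWc, hWU⟩ := locallyConnectedSpace_iff_connected_subsets.1 inferInstance
      (z.1.2 g) _ hnhds
    refine ⟨fiber d g '' W, mem_nhdsWithin_of_mem_nhds ?_,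
      hWc.image _ (continuous_fiber g).continuousOn, ?_⟩
    · filter_upwards [(continuous_coord g).continuousAt.preimage_mem_nhds hW,
        (isOpen_coord_ne g).mem_nhds hg] with y hy hyg
      exact ⟨_, hy, fiber_coord (proj_eq_of_coord_ne hyg)⟩
    · rintro _ ⟨y, hy, rfl⟩
      exact ⟨hWU hy, show (g : G) ∈ N from hpz ▸ hz⟩

theorem subset_range_base_of_isSimpleClosedCurve [T1Space G] [∀ g, T1Space (D g)]
    (hD : ∀ g, ∀ C : Set (D g), ¬ IsSimpleClosedCurve C) {C : Set (Attach d)}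
    (hC : IsSimpleClosedCurve C) : C ⊆ range (base d) := by
  intro c hc
  by_contra hcb
  obtain ⟨g, hg⟩ := exists_coord_ne hcb
  have hcover : C \ {base d g} ⊆ {z | z.1.2 g ≠ d g} ∪ proj ⁻¹' {(g : G)}ᶜ := by
    rintro z ⟨-, hzb⟩
    by_contra! h
    simp only [mem_union, mem_ofPred_eq, mem_preimage, mem_compl_iff, mem_singleton_iff,
      not_or, not_not] at h
    exact hzb (by rw [mem_singleton_iff, ← h.2, base_proj_of_coord_eq h.2 h.1])
  have hsub : C \ {base d g} ⊆ {z | z.1.2 g ≠ d g} :=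
    (hC.isPreconnected_diff_singleton _).subset_left_of_subset_union (isOpen_coord_ne g)
      (isOpen_compl_singleton.preimage continuous_proj)
      (disjoint_left.2 fun z hz hz' ↦ hz' (proj_eq_of_coord_ne hz)) hcover
      ⟨c, ⟨hc, fun h ↦ hcb ⟨g, h.symm⟩⟩, hg⟩
  refine hD g _ ((isEmbedding_fiber (d := d) g).isSimpleClosedCurve_preimage hC fun z hz ↦ ?_)
  by_cases hzb : z = base d g
  · exact ⟨d g, (fiber_self g).trans hzb.symm⟩
  · exact ⟨_, fiber_coord (proj_eq_of_coord_ne (hsub ⟨hz, hzb⟩))⟩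

theorem isCanonicalRetraction [T1Space G] [∀ g, T1Space (D g)] [∀ g, PreconnectedSpace (D g)]
    [∀ g, LocallyConnectedSpace (D g)] :
    IsCanonicalRetraction (range (base d)) fun z ↦ base d (proj z) := by
  refine ⟨?_, fun z hz ↦ ⟨mem_range_self _, ?_⟩⟩
  · rintro _ ⟨x, rfl⟩
    rfl
  obtain ⟨g, hg⟩ := exists_coord_ne hz
  have hpz := proj_eq_of_coord_ne hg
  have hsub : connectedComponentIn (range (base d))ᶜ z ⊆ {z | z.1.2 g ≠ d g} := by
    refine isPreconnected_connectedComponentIn.subset_left_of_subset_union (isOpen_coord_ne g)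
      (isOpen_compl_singleton.preimage continuous_proj : IsOpen (proj ⁻¹' {(g : G)}ᶜ))
      (disjoint_left.2 fun z hz hz' ↦ hz' (proj_eq_of_coord_ne hz)) (fun y hy ↦ ?_)
      ⟨z, mem_connectedComponentIn hz, hg⟩
    by_contra h
    simp only [mem_union, mem_ofPred_eq, mem_preimage, mem_compl_iff, mem_singleton_iff,
      not_or, not_not] at h
    exact connectedComponentIn_subset _ _ hy ⟨_, base_proj_of_coord_eq h.2 h.1⟩
  apply Subset.antisymm
  · rintro _ ⟨hy, x, rfl⟩
    have hclosed : IsClosed (proj ⁻¹' {(g : G)} : Set (Attach d)) :=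
      isClosed_singleton.preimage continuous_proj
    have hx : x = g := closure_minimal (fun y hy ↦ proj_eq_of_coord_ne (hsub hy)) hclosed hy
    exact mem_singleton_iff.2 (congrArg (base d) (hx.trans hpz.symm))
  · rintro _ rfl
    refine ⟨?_, mem_range_self _⟩
    have hmem := image_closure_subset_closure_image (continuous_fiber (d := d) g)
      (mem_image_of_mem _ (mem_closure_connectedComponentIn_compl_singleton hg))
    rw [fiber_self, ← hpz] at hmem
    refine closure_mono (IsPreconnected.subset_connectedComponentIn
      (isPreconnected_connectedComponentIn.image _ (continuous_fiber g).continuousOn)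
      ⟨z.1.2 g, mem_connectedComponentIn hg, fiber_coord hpz⟩ ?_) hmem
    rintro _ ⟨y, hy, rfl⟩ ⟨x, hx⟩
    refine connectedComponentIn_subset _ _ hy ?_
    rw [mem_singleton_iff, ← coord_fiber (d := d) g y, ← hx]
    rfl

end Attach

/-- Given a local dendrite `G`, a countable subset `S ⊆ G`, and a pointed
dendrite `(D g, d g)` for each `g ∈ S`, there is a local dendrite `X` containing `G` as a
subcontinuum containing every simple closed curve of `X`, whose canonical retraction onto
`G` has fiber over `g` homeomorphic (as pointed space) to `(D g, d g)` for `g ∈ S` and a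
singleton fiber over each `g ∉ S`. -/
theorem exists_local_dendrite_with_prescribed_fibers
    {G : Type u} [TopologicalSpace G] (hG : IsLocalDendrite G)
    (S : Set G) (hS : S.Countable)
    (D : S → Type u) [∀ g : S, TopologicalSpace (D g)]
    (d : ∀ g : S, D g) (hD : ∀ g : S, IsDendrite (D g)) :
    ∃ (X : TopCat.{u}) (ι : G → X),
      Topology.IsEmbedding ι ∧
      IsLocalDendrite X ∧
      IsContinuum ↥(Set.range ι) ∧
      (∀ C : Set X, IsSimpleClosedCurve C → C ⊆ Set.range ι) ∧
      ∃ r : X → X, IsCanonicalRetraction (Set.range ι) r ∧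
        (∀ g : S, ∃ e : ↥(r ⁻¹' {ι ↑g}) ≃ₜ D g, ((e.symm (d g) : X) = ι ↑g)) ∧
        (∀ g : G, g ∉ S → r ⁻¹' {ι g} = {ι g}) := by
  obtain ⟨⟨_, _, _, _⟩, hloc⟩ := hG
  have : Countable S := hS
  have hD₁ (g : S) : CompactSpace (D g) := (hD g).1.2.1
  have hD₂ (g : S) : ConnectedSpace (D g) := (hD g).1.2.2.1
  have hD₃ (g : S) : TopologicalSpace.MetrizableSpace (D g) := (hD g).1.2.2.2
  have hD₄ (g : S) : LocallyConnectedSpace (D g) := (hD g).2.1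
  have hcurve (C : Set (Attach d)) (hC : IsSimpleClosedCurve C) : C ⊆ range (Attach.base d) :=
    Attach.subset_range_base_of_isSimpleClosedCurve (fun g ↦ (hD g).2.2) hC
  have hmetr : TopologicalSpace.MetrizableSpace (Attach d) := Attach.metrizableSpace
  have hcompact : CompactSpace (Attach d) := Attach.compactSpace
  have hconn (N : Set G) (hN : IsConnected N) :
      ConnectedSpace (Attach.proj ⁻¹' N : Set (Attach d)) :=
    isConnected_iff_connectedSpace.1 ⟨hN.1.preimage fun x ↦ ⟨Attach.base d x, rfl⟩,
      Attach.isPreconnected_preimage_proj hN.2⟩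
  have hfib (g : G) : (fun z : Attach d ↦ Attach.base d (Attach.proj z)) ⁻¹' {Attach.base d g} =
      {z | Attach.proj z = g} := by
    ext z
    exact Attach.isEmbedding_base.injective.eq_iff
  refine ⟨TopCat.of (Attach d), Attach.base d, Attach.isEmbedding_base, ⟨⟨?_, hcompact, ?_,
    hmetr⟩, fun z ↦ ?_⟩, ⟨?_, ?_, ?_,
    inferInstanceAs (TopologicalSpace.MetrizableSpace (range (Attach.base d)))⟩, hcurve,
    fun z ↦ Attach.base d (Attach.proj z), Attach.isCanonicalRetraction, fun g ↦ ?_,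
    fun g hg ↦ ?_⟩
  · exact Nonempty.map (Attach.base d) inferInstance
  · exact connectedSpace_iff_univ.2
      (isConnected_iff_connectedSpace.2 (hconn univ isConnected_univ))
  · obtain ⟨N, hN, ⟨_, hNcompact, hNconn, _⟩, hNloc, hNcurve⟩ := hloc (Attach.proj z)
    refine ⟨Attach.proj ⁻¹' N, Attach.continuous_proj.continuousAt.preimage_mem_nhds hN,
      ⟨⟨⟨z, mem_of_mem_nhds (s := N) hN⟩, ?_, hconn N (isConnected_iff_connectedSpace.2 hNconn),
        inferInstanceAs (TopologicalSpace.MetrizableSpace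
          (Attach.proj ⁻¹' N : Set (Attach d)))⟩,
      Attach.locallyConnectedSpace_preimage_proj hNloc, fun C hC ↦ ?_⟩⟩
    · exact isCompact_iff_compactSpace.1
        ((isCompact_iff_compactSpace.2 hNcompact).isClosed.preimage
          Attach.continuous_proj).isCompact
    · have hC' := IsEmbedding.subtypeVal.isSimpleClosedCurve_image_iff.2 hC
      refine hNcurve _ (IsEmbedding.subtypeVal.isSimpleClosedCurve_preimage
        (Attach.isEmbedding_base.isSimpleClosedCurve_preimage hC' (hcurve _ hC')) ?_)
      rintro x ⟨y, -, hy⟩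
      have hyN : Attach.proj y.1 ∈ N := y.2
      rw [hy] at hyN
      exact ⟨⟨x, hyN⟩, rfl⟩
  · exact (range_nonempty _).to_subtype
  · exact isCompact_iff_compactSpace.1 (isCompact_range Attach.continuous_base)
  · exact isConnected_iff_connectedSpace.1 (isConnected_range Attach.continuous_base)
  · exact ⟨(Homeomorph.setCongr (hfib g)).trans (Attach.fiberHomeomorph d g),
      Attach.fiber_self g⟩
  · refine (hfib g).trans (Subset.antisymm ?_ ?_)
    · rintro z rfl
      exact (Attach.base_proj_of_notMem hg).symm
    · rintro _ rfl
      rfl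
end
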